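/- arXiv:0707.0434 — 4 statements merged into one kernel-verified Lean document; each statement's English description precedes it below -/
import Mathlib

section
/- Let n ≥ 3 and f₁, …, fₙ be univariate polynomials over ℂ, not all constant, with f₁ + ⋯ + fₙ = 0, such that every vanishing subsum f_{i₁} + ⋯ + f_{i_s} = 0 (with i₁ < ⋯ < i_s) satisfies gcd{f_{i₁}, …, f_{i_s}} = 1. Then max₁≤m≤n deg fₘ ≤ (n−2)·(r(f₁) + r(f₂) + ⋯ + r(fₙ) − 1). -/
open Polynomial

/-- `rdeg g` = number of distinct complex roots of `g` (degree of its radical). -/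
noncomputable def rdeg (g : ℂ[X]) : ℕ := g.roots.toFinset.card

/-- Wronskian matrix. -/
noncomputable def wrM {d : ℕ} (b : Fin d → ℂ[X]) : Matrix (Fin d) (Fin d) ℂ[X] :=
  Matrix.of fun i j => derivative^[(j : ℕ)] (b i)

noncomputable def wr {d : ℕ} (b : Fin d → ℂ[X]) : ℂ[X] := (wrM b).det

/-- scaled version -/
noncomputable def wrS {d : ℕ} (b : Fin d → ℂ[X]) : Matrix (Fin d) (Fin d) ℂ[X] :=
  Matrix.of fun i j => X ^ (j : ℕ) * derivative^[(j : ℕ)] (b i)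

lemma wrS_det {d : ℕ} (b : Fin d → ℂ[X]) :
    (wrS b).det = X ^ (∑ j : Fin d, (j : ℕ)) * wr b := by
  rw [← Finset.prod_pow_eq_pow_sum]
  exact Matrix.det_mul_row (fun j : Fin d => (X : ℂ[X]) ^ (j : ℕ)) (wrM b)

lemma coeff_prod_le {ι : Type*} (s : Finset ι) (p : ι → ℂ[X]) (e : ι → ℕ)
    (h : ∀ i ∈ s, (p i).natDegree ≤ e i) :
    (∏ i ∈ s, p i).natDegree ≤ ∑ i ∈ s, e i ∧
    (∏ i ∈ s, p i).coeff (∑ i ∈ s, e i) = ∏ i ∈ s, (p i).coeff (e i) := by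
  classical
  induction s using Finset.induction_on with
  | empty => simp
  | insert a s ha ih =>
    obtain ⟨h1, h2⟩ := ih fun i hi => h i (Finset.mem_insert_of_mem hi)
    have h3 := h a (Finset.mem_insert_self _ _)
    rw [Finset.prod_insert ha, Finset.sum_insert ha, Finset.prod_insert ha]
    refine ⟨natDegree_mul_le.trans (add_le_add h3 h1), ?_⟩
    rw [coeff_mul_add_eq_of_natDegree_le h3 h1, h2]

lemma det_coeff {d : ℕ} (M : Matrix (Fin d) (Fin d) ℂ[X]) (e : Fin d → ℕ)
    (h : ∀ i j, (M i j).natDegree ≤ e i) :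
    M.det.natDegree ≤ ∑ i, e i ∧
    M.det.coeff (∑ i, e i) = (Matrix.of fun i j => (M i j).coeff (e i)).det := by
  have key : ∀ σ : Equiv.Perm (Fin d), _ := fun σ =>
    coeff_prod_le Finset.univ (fun i => M.transpose (σ i) i) e (fun i _ => h i (σ i))
  rw [← Matrix.det_transpose M, Matrix.det_apply, ← Matrix.det_transpose (Matrix.of _),
    Matrix.det_apply]
  constructor
  · refine natDegree_sum_le_of_forall_le _ _ fun σ _ => ?_
    refine le_trans (natDegree_smul_le _ _) (key σ).1
  · rw [finsetSum_coeff]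
    refine Finset.sum_congr rfl fun σ _ => ?_
    have := (key σ).2
    rw [Units.smul_def, Units.smul_def, coeff_smul, this]
    rfl

lemma wrS_entry {d : ℕ} (b : Fin d → ℂ[X]) (i j : Fin d) :
    (wrS b i j).natDegree ≤ (b i).natDegree ∧
    (wrS b i j).coeff (b i).natDegree =
      (b i).leadingCoeff * (descPochhammer ℂ j).eval ((b i).natDegree : ℂ) := by
  have hc : ∀ m, (wrS b i j).coeff m = (m.descFactorial j : ℂ) * (b i).coeff m := by
    intro m
    simp only [wrS, Matrix.of_apply]
    rw [coeff_X_pow_mul']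
    split_ifs with h
    · rw [coeff_iterate_derivative, Nat.sub_add_cancel h]; simp
    · rw [Nat.descFactorial_of_lt (by omega)]; simp
  constructor
  · rw [natDegree_le_iff_coeff_eq_zero]
    intro m hm
    rw [hc, coeff_eq_zero_of_natDegree_lt hm, mul_zero]
  · rw [hc, descPochhammer_eval_eq_descFactorial, mul_comm]; rfl

lemma wr_natDegree {d : ℕ} (b : Fin d → ℂ[X]) (h : wr b ≠ 0) :
    (wr b).natDegree + ∑ j : Fin d, (j : ℕ) ≤ ∑ i, (b i).natDegree := by
  have := (det_coeff (wrS b) _ fun i j => (wrS_entry b i j).1).1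
  rw [wrS_det, natDegree_X_pow_mul _ h] at this
  omega

lemma wr_ne_zero_of_inj {d : ℕ} (b : Fin d → ℂ[X]) (h0 : ∀ i, b i ≠ 0)
    (hinj : Function.Injective fun i => (b i).natDegree) : wr b ≠ 0 := by
  intro hw
  have h := (det_coeff (wrS b) _ fun i j => (wrS_entry b i j).1).2
  rw [wrS_det, hw, mul_zero, coeff_zero] at h
  simp_rw [(wrS_entry b _ _).2] at h
  have h2 := Matrix.det_mul_column (fun i => (b i).leadingCoeff)
    (Matrix.of fun i j : Fin d => (descPochhammer ℂ j).eval ((b i).natDegree : ℂ))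
  rw [show (Matrix.of fun i j : Fin d => (b i).leadingCoeff *
    (descPochhammer ℂ j).eval ((b i).natDegree : ℂ)).det = _ from h2] at h
  rw [← Matrix.det_eval_matrixOfPolynomials_eq_det_vandermonde (fun i => ((b i).natDegree : ℂ))
    (fun j : Fin d => descPochhammer ℂ j) (fun j => descPochhammer_natDegree _ _)
    (fun j => monic_descPochhammer _ _)] at h
  rcases mul_eq_zero.1 h.symm with h | h
  · exact Finset.prod_ne_zero_iff.2 (fun i _ => leadingCoeff_ne_zero.2 (h0 i)) h
  · refine Matrix.det_vandermonde_ne_zero_iff.2 ?_ h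
    intro i j hij
    exact hinj (by simpa using hij)

lemma wr_ne_zero {d : ℕ} : ∀ (N : ℕ) (b : Fin d → ℂ[X]), ∑ i, (b i).natDegree = N →
    LinearIndependent ℂ b → wr b ≠ 0 := by
  intro N
  induction N using Nat.strong_induction_on with
  | _ N ih =>
  intro b hN hb
  by_cases hinj : Function.Injective fun i => (b i).natDegree
  · exact wr_ne_zero_of_inj b (fun i => hb.ne_zero i) hinj
  simp only [Function.Injective, not_forall] at hinj
  obtain ⟨i, j, hij, hne⟩ := hinj
  have hbi := hb.ne_zero i
  have hbj := hb.ne_zero j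
  set c : ℂ := -((b i).leadingCoeff / (b j).leadingCoeff) with hc
  have hcj : (b j).leadingCoeff ≠ 0 := leadingCoeff_ne_zero.2 hbj
  set b' := Function.update b i (b i + c • b j) with hb'
  have hind : LinearIndependent ℂ b' := by
    rw [Fintype.linearIndependent_iff] at hb ⊢
    intro g hg
    have h1 := hb (Function.update g j (g j + c * g i)) (by
      rw [← hg, ← sub_eq_zero, ← Finset.sum_sub_distrib]
      rw [← Finset.add_sum_erase _ _ (Finset.mem_univ i),
        ← Finset.add_sum_erase _ _ (Finset.mem_erase.2 ⟨Ne.symm hne, Finset.mem_univ j⟩),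
        Finset.sum_eq_zero]
      · simp [hb', hne, Ne.symm hne, smul_add, add_smul, mul_smul, smul_comm c]
      · intro k hk
        simp only [Finset.mem_erase] at hk
        simp [hb', hk.1, hk.2.1])
    have hi : g i = 0 := by simpa [hne] using h1 i
    intro k
    by_cases hk : k = j
    · subst hk; simpa [hi] using h1 k
    · simpa [hk] using h1 k
  have hwr : wr b' = wr b := by
    have := Matrix.det_updateRow_add_smul_self (wrM b) hne (C c)
    rw [wr, wr, ← this]
    congr 1
    ext1 k l
    by_cases hk : k = i
    · subst hk
      simp [wrM, hb', smul_eq_C_mul, iterate_map_add, iterate_derivative_C_mul]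
    · simp [wrM, hb', hk]
  rw [← hwr]
  refine ih _ ?_ b' rfl hind
  rw [← hN]
  have hlt : (b i + c • b j).natDegree < (b i).natDegree := by
    have hd : (b i + c • b j).degree < (b i).degree := by
      rw [smul_eq_C_mul]
      have hc0 : c ≠ 0 := by
        simp [hc, hbi, hbj]
      have e1 : (b i).degree = (b j).degree := by
        rw [degree_eq_natDegree hbi, degree_eq_natDegree hbj]; exact_mod_cast hij
      have := degree_sub_lt_left (p := b i) (q := C (-c) * b j)
        (by rw [degree_C_mul (neg_ne_zero.2 hc0), e1]) hbi
        (by simp [hc, hcj])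
      simpa using this
    have hne0 : b i + c • b j ≠ 0 := by
      have := hind.ne_zero i
      simpa [hb'] using this
    exact natDegree_lt_natDegree hne0 hd
  refine Finset.sum_lt_sum (fun k _ => ?_) ⟨i, Finset.mem_univ _, by simpa [hb'] using hlt⟩
  by_cases hk : k = i
  · subst hk; simpa [hb'] using hlt.le
  · simp [hb', hk]

lemma wr_dvd {d : ℕ} (b b' : Fin d → ℂ[X]) (h : ∀ i, b' i ∈ Submodule.span ℂ (Set.range b)) :
    wr b ∣ wr b' := by
  simp_rw [Submodule.mem_span_range_iff_exists_fun] at h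
  choose A hA using h
  have : wrM b' = (Matrix.of fun i j => C (A i j)) * wrM b := by
    ext1 i j
    simp only [wrM, Matrix.mul_apply, Matrix.of_apply]
    rw [← hA, iterate_derivative_sum]
    simp [smul_eq_C_mul, iterate_derivative_C_mul]
  rw [wr, wr, this, Matrix.det_mul]
  exact dvd_mul_left _ _

lemma wr_local {d : ℕ} (b : Fin d → ℂ[X]) (a : ℂ) (h : wr b ≠ 0) :
    ∑ i, ((b i).rootMultiplicity a - (d - 1)) ≤ (wr b).rootMultiplicity a := by
  rw [le_rootMultiplicity_iff h, ← Finset.prod_pow_eq_pow_sum]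
  have : ∀ i j : Fin d, (X - C a) ^ ((b i).rootMultiplicity a - (d - 1)) ∣ wrM b i j := by
    intro i j
    refine (pow_dvd_pow _ ?_).trans
      (pow_sub_dvd_iterate_derivative_of_pow_dvd (j : ℕ) (pow_rootMultiplicity_dvd (b i) a))
    have := j.2
    omega
  choose M hM using this
  have e : wrM b = Matrix.of fun i j => (X - C a) ^ ((b i).rootMultiplicity a - (d - 1)) * M i j := by
    ext1 i j
    exact hM i j
  rw [wr, e]
  have e2 := Matrix.det_mul_column (fun i => (X - C a) ^ ((b i).rootMultiplicity a - (d - 1)))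
    (Matrix.of M)
  simp only [Matrix.of_apply] at e2
  rw [e2]
  exact dvd_mul_right _ _

lemma sum_mult_le (T : Finset ℂ) (g : ℂ[X]) :
    ∑ a ∈ T, g.rootMultiplicity a ≤ g.natDegree := by
  classical
  refine le_trans ?_ (card_roots' g)
  rw [← Multiset.toFinset_sum_count_eq]
  simp_rw [← count_roots]
  exact Finset.sum_le_sum_of_ne_zero fun a _ ha => by
    rw [Multiset.mem_toFinset]; exact Multiset.count_ne_zero.1 ha

lemma sum_mult_eq (T : Finset ℂ) (g : ℂ[X]) (h : g.roots.toFinset ⊆ T) :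
    ∑ a ∈ T, g.rootMultiplicity a = g.natDegree := by
  classical
  rw [(IsAlgClosed.splits g).natDegree_eq_card_roots, ← Multiset.toFinset_sum_count_eq]
  simp_rw [← count_roots]
  symm
  refine Finset.sum_subset h fun a _ ha => ?_
  rw [Multiset.mem_toFinset] at ha
  exact Multiset.count_eq_zero.2 ha

lemma mult_span {ι : Type*} (f : ι → ℂ[X]) (E : Set ι) (a : ℂ) (μ D : ℕ)
    (h : ∀ i ∈ E, μ ≤ (f i).rootMultiplicity a) (hD : ∀ i ∈ E, (f i).natDegree ≤ D)
    (g : ℂ[X]) (hg : g ∈ Submodule.span ℂ (f '' E)) (hg0 : g ≠ 0) :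
    μ ≤ g.rootMultiplicity a ∧ g.natDegree ≤ D := by
  rw [le_rootMultiplicity_iff hg0]
  clear hg0
  induction hg using Submodule.span_induction with
  | mem x hx =>
    obtain ⟨i, hi, rfl⟩ := hx
    exact ⟨(pow_dvd_pow _ (h i hi)).trans (pow_rootMultiplicity_dvd _ _), hD i hi⟩
  | zero => simp
  | add x y _ _ hx hy =>
    exact ⟨dvd_add hx.1 hy.1, (natDegree_add_le _ _).trans (max_le hx.2 hy.2)⟩
  | smul c x _ hx =>
    exact ⟨by rw [smul_eq_C_mul]; exact hx.1.mul_left _, (natDegree_smul_le _ _).trans hx.2⟩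

lemma exists_ear {n : ℕ} (f : Fin n → ℂ[X]) (S E : Finset (Fin n)) (hES : E ⊆ S)
    (hS : ∑ i ∈ S, f i = 0) (hE : ∑ i ∈ E, f i ≠ 0) :
    ∃ (I : Finset (Fin n)) (a : Fin n → ℂ), I ⊆ S \ E ∧ I.Nonempty ∧ (∀ i ∈ I, a i ≠ 0) ∧
      ∑ i ∈ I, a i • f i ≠ 0 ∧ ∑ i ∈ I, a i • f i ∈ Submodule.span ℂ (f '' E) ∧
      ∀ c : Fin n → ℂ, ∀ i₀ ∈ I, c i₀ = 0 →
        ∑ i ∈ I, c i • f i ∈ Submodule.span ℂ (f '' E) → ∀ i ∈ I, c i = 0 := by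
  classical
  let P : ℕ → Prop := fun k => ∃ (I : Finset (Fin n)) (a : Fin n → ℂ), I.card = k ∧ I ⊆ S \ E ∧
    ∑ i ∈ I, a i • f i ≠ 0 ∧ ∑ i ∈ I, a i • f i ∈ Submodule.span ℂ (f '' E)
  have hsd : ∑ i ∈ S \ E, f i = - ∑ i ∈ E, f i := by
    have := Finset.sum_sdiff (f := f) hES
    rw [hS] at this
    exact eq_neg_of_add_eq_zero_left this
  have hP : ∃ k, P k := by
    refine ⟨_, S \ E, fun _ => 1, rfl, subset_rfl, ?_, ?_⟩
    · simp only [one_smul]; rw [hsd]; exact neg_ne_zero.2 hE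
    · simp only [one_smul]; rw [hsd]
      refine Submodule.neg_mem _ (Submodule.sum_mem _ fun i hi => Submodule.subset_span ⟨i, hi, rfl⟩)
  obtain ⟨I, a, hcard, hI, hne, hmem⟩ := Nat.find_spec hP
  have hmin : ∀ i ∈ I, ∀ a' : Fin n → ℂ, a' i = 0 →
      ∑ i ∈ I, a' i • f i ∈ Submodule.span ℂ (f '' E) → ∑ i ∈ I, a' i • f i = 0 := by
    intro i hi a' ha' hm
    by_contra hcon
    have he : ∑ j ∈ I.erase i, a' j • f j = ∑ j ∈ I, a' j • f j :=
      Finset.sum_erase _ (by simp [ha'])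
    refine Nat.find_min hP (m := (I.erase i).card) ?_
      ⟨I.erase i, a', rfl, (Finset.erase_subset _ _).trans hI, ?_, ?_⟩
    · rw [← hcard]; exact Finset.card_erase_lt_of_mem hi
    · rwa [he]
    · rwa [he]
  refine ⟨I, a, hI, ?_, ?_, hne, hmem, ?_⟩
  · rw [Finset.nonempty_iff_ne_empty]
    rintro rfl
    simp at hne
  · intro i hi h0
    exact hne (hmin i hi a h0 hmem)
  · intro c i₀ hi₀ hc₀ hc i₁ hi₁
    by_contra hcon
    have hz := hmin i₀ hi₀ c hc₀ hc
    have hsum : ∑ i ∈ I, (a i - a i₁ / c i₁ * c i) • f i = ∑ i ∈ I, a i • f i := by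
      simp_rw [sub_smul, mul_smul]
      rw [Finset.sum_sub_distrib, ← Finset.smul_sum, hz, smul_zero, sub_zero]
    refine hne ?_
    rw [← hsum]
    refine hmin i₁ hi₁ (fun i => a i - a i₁ / c i₁ * c i) ?_ ?_
    · simp [hcon]
    · rw [hsum]; exact hmem

/-- `B` is a basis of the span of `E`. -/
def IsB {n : ℕ} (f : Fin n → ℂ[X]) (E B : Finset (Fin n)) : Prop :=
  B ⊆ E ∧ (∀ c : Fin n → ℂ, ∑ i ∈ B, c i • f i = 0 → ∀ i ∈ B, c i = 0) ∧
    ∀ i ∈ E, f i ∈ Submodule.span ℂ (f '' B)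

lemma IsB.step {n : ℕ} {f : Fin n → ℂ[X]} {E B I : Finset (Fin n)} (h : IsB f E B)
    (hIE : Disjoint I E) (a : Fin n → ℂ) (ha : ∀ i ∈ I, a i ≠ 0)
    (hm : ∑ i ∈ I, a i • f i ∈ Submodule.span ℂ (f '' E))
    (hc : ∀ c : Fin n → ℂ, ∀ i₀ ∈ I, c i₀ = 0 →
        ∑ i ∈ I, c i • f i ∈ Submodule.span ℂ (f '' E) → ∀ i ∈ I, c i = 0)
    (i₀ : Fin n) (hi₀ : i₀ ∈ I) : IsB f (E ∪ I) (B ∪ I.erase i₀) := by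
  classical
  obtain ⟨h1, h2, h3⟩ := h
  have hdis : Disjoint B (I.erase i₀) :=
    (hIE.symm.mono_left h1).mono_right (Finset.erase_subset _ _)
  have hspan : Submodule.span ℂ (f '' E) ≤ Submodule.span ℂ (f '' B) := by
    rw [Submodule.span_le]
    rintro _ ⟨i, hi, rfl⟩
    exact h3 i hi
  have hmono : Submodule.span ℂ (f '' B) ≤ Submodule.span ℂ (f '' (B ∪ I.erase i₀ : Finset _)) :=
    Submodule.span_mono (Set.image_mono (by simp))
  refine ⟨Finset.union_subset_union h1 (Finset.erase_subset _ _), ?_, ?_⟩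
  · intro c hsum
    rw [Finset.sum_union hdis] at hsum
    have e1 : ∑ i ∈ I, (Function.update c i₀ 0) i • f i = ∑ i ∈ I.erase i₀, c i • f i := by
      rw [← Finset.add_sum_erase _ _ hi₀]
      simp only [Function.update_self, zero_smul, zero_add]
      refine Finset.sum_congr rfl fun i hi => ?_
      rw [Function.update_of_ne (Finset.ne_of_mem_erase hi)]
    have h4 := hc (Function.update c i₀ 0) i₀ hi₀ (by simp) (by
      rw [e1, eq_neg_of_add_eq_zero_right hsum]
      exact Submodule.neg_mem _ (Submodule.sum_mem _ fun i hi =>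
        Submodule.smul_mem _ _ (Submodule.subset_span ⟨i, h1 hi, rfl⟩)))
    have h5 : ∀ i ∈ I.erase i₀, c i = 0 := by
      intro i hi
      have := h4 i (Finset.mem_of_mem_erase hi)
      rwa [Function.update_of_ne (Finset.ne_of_mem_erase hi)] at this
    have h6 : ∑ i ∈ I.erase i₀, c i • f i = 0 :=
      Finset.sum_eq_zero fun i hi => by rw [h5 i hi, zero_smul]
    rw [h6, add_zero] at hsum
    intro i hi
    rcases Finset.mem_union.1 hi with hi | hi
    · exact h2 c hsum i hi
    · exact h5 i hi
  · intro i hi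
    rcases Finset.mem_union.1 hi with hi | hi
    · exact hmono (h3 i hi)
    by_cases hii : i = i₀
    · subst hii
      have e : f i = (a i)⁻¹ • (∑ j ∈ I, a j • f j - ∑ j ∈ I.erase i, a j • f j) := by
        rw [← Finset.add_sum_erase _ _ hi, add_sub_cancel_right, smul_smul,
          inv_mul_cancel₀ (ha i hi), one_smul]
      rw [e]
      refine Submodule.smul_mem _ _ (Submodule.sub_mem _ (hmono (hspan hm)) ?_)
      refine Submodule.sum_mem _ fun j hj => Submodule.smul_mem _ _ (Submodule.subset_span
        ⟨j, ?_, rfl⟩)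
      exact Finset.mem_coe.2 (Finset.mem_union_right _ hj)
    · exact Submodule.subset_span ⟨i, by simp [hi, hii], rfl⟩

/-- Inductive height bound. -/
def QQ {n : ℕ} (f : Fin n → ℂ[X]) (T : Finset ℂ) (E : Finset (Fin n)) : Prop :=
  ∃ (D : ℕ) (μ : ℂ → ℕ) (B₀ : Finset (Fin n)) (B : ℂ → Finset (Fin n)),
    (∀ i ∈ E, (f i).natDegree ≤ D) ∧ (∀ a, ∀ i ∈ E, μ a ≤ (f i).rootMultiplicity a) ∧
    IsB f E B₀ ∧ (∀ a, IsB f E (B a)) ∧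
    D + ∑ i ∈ B₀, (f i).natDegree ≤
      ∑ a ∈ T, μ a + ∑ a ∈ T, ∑ i ∈ B a, (f i).rootMultiplicity a

lemma QQ.step {n : ℕ} {f : Fin n → ℂ[X]} {T : Finset ℂ}
    (hT : ∀ i, ∑ a ∈ T, (f i).rootMultiplicity a = (f i).natDegree)
    {S E : Finset (Fin n)} (hES : E ⊆ S)
    (hS : ∑ i ∈ S, f i = 0) (hE : ∑ i ∈ E, f i ≠ 0) (hQ : QQ f T E) :
    ∃ E', E' ⊆ S ∧ E.card < E'.card ∧ QQ f T E' := by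
  classical
  obtain ⟨I, a, hI, hIne, ha, hg, hm, hc⟩ := exists_ear f S E hES hS hE
  obtain ⟨D, μ, B₀, B, hD, hμ, hB₀, hB, hle⟩ := hQ
  have hdis : Disjoint I E := Finset.disjoint_of_subset_left hI Finset.sdiff_disjoint
  obtain ⟨j, hj, hjmax⟩ := Finset.exists_max_image I (fun i => (f i).natDegree) hIne
  have hmin := fun α : ℂ => Finset.exists_min_image I (fun i => (f i).rootMultiplicity α) hIne
  choose k hk hkmin using hmin
  refine ⟨E ∪ I, Finset.union_subset hES (hI.trans Finset.sdiff_subset), ?_, ?_⟩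
  · rw [Finset.card_union_of_disjoint hdis.symm]
    have := hIne.card_pos
    omega
  have hgI : ∑ i ∈ I, a i • f i ∈ Submodule.span ℂ (f '' (I : Set (Fin n))) :=
    Submodule.sum_mem _ fun i hi => Submodule.smul_mem _ _ (Submodule.subset_span ⟨i, hi, rfl⟩)
  set g := ∑ i ∈ I, a i • f i with hgdef
  have g1 := fun α => mult_span f E α (μ α) D (hμ α) hD g hm hg
  have g2 := fun α => mult_span f I α ((f (k α)).rootMultiplicity α) (f j).natDegree
    (hkmin α) hjmax g hgI hg
  refine ⟨max D (f j).natDegree, fun α => min (μ α) ((f (k α)).rootMultiplicity α),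
    B₀ ∪ I.erase j, fun α => B α ∪ I.erase (k α), ?_, ?_, ?_, ?_, ?_⟩
  · intro i hi
    rcases Finset.mem_union.1 hi with hi | hi
    · exact le_max_of_le_left (hD i hi)
    · exact le_max_of_le_right (hjmax i hi)
  · intro α i hi
    rcases Finset.mem_union.1 hi with hi | hi
    · exact min_le_of_left_le (hμ α i hi)
    · exact min_le_of_right_le (hkmin α i hi)
  · exact hB₀.step hdis a ha hm hc j hj
  · exact fun α => (hB α).step hdis a ha hm hc _ (hk α)
  · have hd : ∀ B' i, B' ⊆ E → Disjoint B' (I.erase i) := fun B' i hB' =>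
      (hdis.symm.mono_left hB').mono_right (Finset.erase_subset _ _)
    rw [Finset.sum_union (hd _ _ hB₀.1)]
    have e0 : ∀ α, ∑ i ∈ B α ∪ I.erase (k α), (f i).rootMultiplicity α =
        ∑ i ∈ B α, (f i).rootMultiplicity α + ∑ i ∈ I.erase (k α), (f i).rootMultiplicity α :=
      fun α => Finset.sum_union (hd _ _ (hB α).1)
    simp_rw [e0]
    rw [Finset.sum_add_distrib]
    have e1 := Finset.add_sum_erase I (fun i => (f i).natDegree) hj
    have e2 : ∑ α ∈ T, (f (k α)).rootMultiplicity α +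
        ∑ α ∈ T, ∑ i ∈ I.erase (k α), (f i).rootMultiplicity α = ∑ i ∈ I, (f i).natDegree := by
      rw [← Finset.sum_add_distrib]
      simp_rw [← hT]
      rw [Finset.sum_comm]
      refine Finset.sum_congr rfl fun α _ => ?_
      exact Finset.add_sum_erase I (fun i => (f i).rootMultiplicity α) (hk α)
    have e3 : ∑ α ∈ T, min (μ α) ((f (k α)).rootMultiplicity α) +
        ∑ α ∈ T, max (μ α) ((f (k α)).rootMultiplicity α) =
        ∑ α ∈ T, μ α + ∑ α ∈ T, (f (k α)).rootMultiplicity α := by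
      rw [← Finset.sum_add_distrib, ← Finset.sum_add_distrib]
      exact Finset.sum_congr rfl fun α _ => min_add_max _ _
    have e4 : ∑ α ∈ T, max (μ α) ((f (k α)).rootMultiplicity α) ≤ g.natDegree :=
      (Finset.sum_le_sum fun α _ => max_le (g1 α).1 (g2 α).1).trans (sum_mult_le T g)
    have e5 := (g1 0).2
    have e6 := (g2 0).2
    have e7 := min_add_max D (f j).natDegree
    have e8 := le_min e5 e6
    omega

lemma QQ_start {n : ℕ} {f : Fin n → ℂ[X]} {T : Finset ℂ}
    (hT : ∀ i, ∑ a ∈ T, (f i).rootMultiplicity a = (f i).natDegree) (m : Fin n) (hm : f m ≠ 0) :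
    QQ f T {m} := by
  have hb : IsB f {m} {m} := by
    refine ⟨subset_rfl, ?_, ?_⟩
    · intro c hc i hi
      rw [Finset.mem_singleton] at hi
      subst hi
      simpa [hm] using hc
    · intro i hi
      exact Submodule.subset_span ⟨i, hi, rfl⟩
  refine ⟨(f m).natDegree, fun a => (f m).rootMultiplicity a, {m}, fun _ => {m}, ?_, ?_, hb,
    fun _ => hb, ?_⟩
  · simp
  · simp
  · simp [hT]

lemma QQ.full {n : ℕ} {f : Fin n → ℂ[X]} {T : Finset ℂ}
    (hT : ∀ i, ∑ a ∈ T, (f i).rootMultiplicity a = (f i).natDegree)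
    {S : Finset (Fin n)} (hS : ∑ i ∈ S, f i = 0) (m : Fin n) (hmS : m ∈ S) (hm : f m ≠ 0)
    (hmin : ∀ E ⊆ S, E.Nonempty → ∑ i ∈ E, f i = 0 → E = S) : QQ f T S := by
  classical
  obtain ⟨E, hE, hmax⟩ := Finset.exists_max_image
    (S.powerset.filter fun E => E.Nonempty ∧ QQ f T E) Finset.card
    ⟨{m}, by simp [hmS, QQ_start hT m hm]⟩
  simp only [Finset.mem_filter, Finset.mem_powerset] at hE hmax
  by_cases h : ∑ i ∈ E, f i = 0
  · rw [← hmin E hE.1 hE.2.1 h]; exact hE.2.2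
  · obtain ⟨E', h1, h2, h3⟩ := hE.2.2.step hT hE.1 hS h
    have := hmax E' ⟨h1, Finset.card_pos.1 (by omega), h3⟩
    omega

lemma IsB.linInd {n : ℕ} {f : Fin n → ℂ[X]} {E B : Finset (Fin n)} (h : IsB f E B) :
    LinearIndepOn ℂ f (B : Set (Fin n)) := by
  rw [linearIndepOn_finset_iff]
  exact h.2.1

lemma IsB.span_eq {n : ℕ} {f : Fin n → ℂ[X]} {E B : Finset (Fin n)} (h : IsB f E B) :
    Submodule.span ℂ (f '' B) = Submodule.span ℂ (f '' E) := by
  refine le_antisymm (Submodule.span_mono (Set.image_mono (by exact_mod_cast h.1))) ?_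
  rw [Submodule.span_le]
  rintro _ ⟨i, hi, rfl⟩
  exact h.2.2 i hi

lemma IsB.card_eq {n : ℕ} {f : Fin n → ℂ[X]} {E B : Finset (Fin n)} (h : IsB f E B) :
    B.card = Module.finrank ℂ (Submodule.span ℂ (f '' E)) := by
  rw [← h.span_eq, Set.image_eq_range]
  have := finrank_span_eq_card (R := ℂ) (b := fun x : (B : Set (Fin n)) => f x) h.linInd
  rw [this]
  simp

lemma sum_emb {n d : ℕ} (B : Finset (Fin n)) (h : B.card = d) (φ : Fin n → ℕ) :
    ∑ k : Fin d, φ (B.orderEmbOfFin h k) = ∑ i ∈ B, φ i := by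
  conv_rhs => rw [← Finset.map_orderEmbOfFin_univ B h]
  rw [Finset.sum_map]
  rfl

lemma range_emb {n d : ℕ} (f : Fin n → ℂ[X]) (B : Finset (Fin n)) (h : B.card = d) :
    Set.range (fun k : Fin d => f (B.orderEmbOfFin h k)) = f '' B := by
  rw [← Finset.range_orderEmbOfFin B h, ← Set.range_comp]
  rfl

lemma IsB.wr_ne {n d : ℕ} {f : Fin n → ℂ[X]} {E B : Finset (Fin n)} (h : IsB f E B)
    (hd : B.card = d) : wr (fun k : Fin d => f (B.orderEmbOfFin hd k)) ≠ 0 := by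
  refine wr_ne_zero _ _ rfl ?_
  have := h.linInd
  exact LinearIndependent.comp this
    (fun k : Fin d => (⟨B.orderEmbOfFin hd k, Finset.orderEmbOfFin_mem B hd k⟩ : (B : Set (Fin n))))
    (fun x y hxy => (B.orderEmbOfFin hd).injective (by simpa using hxy))

/-- Main estimate from the Wronskian. -/
lemma main_bound {n d : ℕ} (f : Fin n → ℂ[X]) (T : Finset ℂ) (E B₀ : Finset (Fin n))
    (B : ℂ → Finset (Fin n)) (hB₀ : IsB f E B₀) (hB : ∀ a, IsB f E (B a)) (hd : B₀.card = d) :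
    ∑ a ∈ T, ∑ i ∈ B a, ((f i).rootMultiplicity a - (d - 1)) + ∑ j : Fin d, (j : ℕ) ≤
      ∑ i ∈ B₀, (f i).natDegree := by
  have hd' : ∀ a, (B a).card = d := fun a => by rw [(hB a).card_eq, ← hB₀.card_eq, hd]
  have h1 := wr_natDegree _ (hB₀.wr_ne hd)
  rw [sum_emb B₀ hd fun i => (f i).natDegree] at h1
  refine le_trans (Nat.add_le_add_right ?_ _) h1
  refine le_trans (Finset.sum_le_sum fun a _ => ?_) (sum_mult_le T _)
  have h2 := wr_local _ a ((hB a).wr_ne (hd' a))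
  rw [sum_emb (B a) (hd' a) fun i => (f i).rootMultiplicity a - (d - 1)] at h2
  refine h2.trans (rootMultiplicity_le_rootMultiplicity_of_dvd (hB₀.wr_ne hd) (wr_dvd _ _ ?_) a)
  intro k
  rw [range_emb, (hB a).span_eq]
  exact Submodule.subset_span ⟨_, hB₀.1 (Finset.orderEmbOfFin_mem B₀ hd k), rfl⟩

theorem stmt4 (n : ℕ) (hn : 3 ≤ n) (f : Fin n → ℂ[X])
    (hconst : ¬ ∀ i, (f i).natDegree = 0)
    (hsum : ∑ i, f i = 0)
    (hgcd : ∀ S : Finset (Fin n), S.Nonempty → (∑ i ∈ S, f i) = 0 →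
      ∀ p : ℂ[X], (∀ i ∈ S, p ∣ f i) → IsUnit p) :
    ∀ m, ((f m).natDegree : ℤ) ≤
      ((n : ℤ) - 2) * ((∑ i, (rdeg (f i) : ℤ)) - 1) := by
  classical
  intro m
  have hf0 : ∀ i, f i ≠ 0 := by
    intro i hi
    have := hgcd {i} (by simp) (by simpa using hi) 0 (by simp [hi])
    simp at this
  set T : Finset ℂ := Finset.univ.biUnion fun i => (f i).roots.toFinset with hTdef
  have hsub : ∀ i, (f i).roots.toFinset ⊆ T := fun i =>
    Finset.subset_biUnion_of_mem (fun i => (f i).roots.toFinset) (Finset.mem_univ i)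
  have hT : ∀ i, ∑ a ∈ T, (f i).rootMultiplicity a = (f i).natDegree := fun i =>
    sum_mult_eq T (f i) (hsub i)
  -- minimal vanishing subset through `m`
  obtain ⟨S, hS, hSmin⟩ := Finset.exists_min_image
    (Finset.univ.filter fun S : Finset (Fin n) => m ∈ S ∧ ∑ i ∈ S, f i = 0) Finset.card
    ⟨Finset.univ, by simp [hsum]⟩
  simp only [Finset.mem_filter, Finset.mem_univ, true_and] at hS hSmin
  obtain ⟨hmS, hS0⟩ := hS
  have hmin : ∀ E ⊆ S, E.Nonempty → ∑ i ∈ E, f i = 0 → E = S := by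
    intro E hES hE hE0
    by_cases hmE : m ∈ E
    · exact Finset.eq_of_subset_of_card_le hES (hSmin E ⟨hmE, hE0⟩)
    · have h1 := Finset.sum_sdiff (f := f) hES
      rw [hE0, hS0, add_zero] at h1
      have h2 := hSmin (S \ E) ⟨by simp [hmS, hmE], h1⟩
      rw [Finset.card_sdiff_of_subset hES] at h2
      have := hE.card_pos
      have := Finset.card_le_card hES
      omega
  obtain ⟨D, μ, B₀, B, hD, hμ, hB₀, hB, hle⟩ := QQ.full hT hS0 m hmS (hf0 m) hmin
  have hμ0 : ∀ a, μ a = 0 := by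
    intro a
    by_contra hcon
    refine not_isUnit_X_sub_C a (hgcd S ⟨m, hmS⟩ hS0 (X - C a) fun i hi => ?_)
    rw [dvd_iff_isRoot, ← rootMultiplicity_pos (hf0 i)]
    have := hμ a i hi
    omega
  have hmb := main_bound f T S B₀ B hB₀ hB rfl
  set d := B₀.card with hd
  have hd1 : d + 1 ≤ n := by
    by_contra hcon
    have : B₀ = Finset.univ := by
      apply Finset.eq_univ_of_card
      have := Finset.card_le_univ B₀
      simp only [Fintype.card_fin] at this ⊢
      omega
    have h := hB₀.2.1 (fun _ => 1) (by rw [this]; simpa using hsum) m (by simp [this])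
    simp at h
  have hd0 : 1 ≤ d := by
    rw [Nat.one_le_iff_ne_zero]
    intro h
    have h1 := hB₀.2.2 m hmS
    rw [Finset.card_eq_zero.1 (hd.symm.trans h)] at h1
    simp at h1
    exact hf0 m h1
  have hr : ∑ a ∈ T, ∑ i ∈ B a, (if a ∈ (f i).roots.toFinset then 1 else 0) ≤
      ∑ i, rdeg (f i) := by
    calc _ ≤ ∑ a ∈ T, ∑ i, (if a ∈ (f i).roots.toFinset then 1 else 0) :=
          Finset.sum_le_sum fun a _ => Finset.sum_le_sum_of_subset (Finset.subset_univ _)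
      _ = ∑ i, rdeg (f i) := by
          rw [Finset.sum_comm]
          refine Finset.sum_congr rfl fun i _ => ?_
          rw [← Finset.card_filter, Finset.filter_mem_eq_inter,
            Finset.inter_eq_right.2 (hsub i)]
          rfl
  have hloc : ∑ a ∈ T, ∑ i ∈ B a, (f i).rootMultiplicity a ≤
      ∑ a ∈ T, ∑ i ∈ B a, ((f i).rootMultiplicity a - (d - 1)) +
      (d - 1) * ∑ a ∈ T, ∑ i ∈ B a, (if a ∈ (f i).roots.toFinset then 1 else 0) := by
    rw [Finset.mul_sum, ← Finset.sum_add_distrib]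
    refine Finset.sum_le_sum fun a _ => ?_
    rw [Finset.mul_sum, ← Finset.sum_add_distrib]
    refine Finset.sum_le_sum fun i _ => ?_
    split_ifs with h
    · omega
    · have : (f i).rootMultiplicity a = 0 := by
        rw [Multiset.mem_toFinset, ← Multiset.count_eq_zero, count_roots] at h
        exact h
      omega
  have hjs : d - 1 ≤ ∑ j : Fin d, (j : ℕ) := by
    have := Finset.single_le_sum (f := fun j : Fin d => (j : ℕ)) (fun _ _ => Nat.zero_le _)
      (Finset.mem_univ (⟨d - 1, by omega⟩ : Fin d))
    simpa using this
  have hR : 1 ≤ ∑ i, rdeg (f i) := by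
    push Not at hconst
    obtain ⟨i, hi⟩ := hconst
    refine le_trans ?_ (Finset.single_le_sum (f := fun i => rdeg (f i))
      (fun _ _ => Nat.zero_le _) (Finset.mem_univ i))
    have : (f i).roots ≠ 0 := by
      intro h
      have := (IsAlgClosed.splits (f i)).natDegree_eq_card_roots
      rw [h] at this
      exact hi (by simpa using this)
    change 0 < (f i).roots.toFinset.card
    rw [Finset.card_pos, Multiset.toFinset_nonempty]
    exact this
  have hmD := hD m hmS
  simp only [hμ0, Finset.sum_const_zero, zero_add] at hle
  have hfin : (f m).natDegree + (d - 1) ≤ (d - 1) * ∑ i, rdeg (f i) := by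
    have := Nat.mul_le_mul_left (d - 1) hr
    omega
  rw [← Nat.cast_sum]
  generalize ∑ i, rdeg (f i) = R at hfin hR
  obtain ⟨e, hde⟩ : ∃ e, d = e + 1 := ⟨d - 1, by omega⟩
  rw [hde, Nat.add_sub_cancel] at hfin
  have h1 : ((f m).natDegree : ℤ) + e ≤ e * R := by exact_mod_cast hfin
  have h2 : (e : ℤ) ≤ (n : ℤ) - 2 := by omega
  have h3 : (1 : ℤ) ≤ R := by exact_mod_cast hR
  nlinarith [mul_le_mul_of_nonneg_right h2 (sub_nonneg.2 h3)]
end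

section
/- Let n ≥ 3 and f₁, …, fₙ be nonzero univariate polynomials over ℂ, not all constant, with gcd{f₁,…,fₙ} = 1, f₁ + ⋯ + fₙ = 0, and no proper nonempty subsum of f₁ + ⋯ + fₙ vanishing. Let d be the dimension of the ℂ-vector space spanned by f₁, …, fₙ. Then there exists ρ with 2 ≤ ρ ≤ d such that max₁≤m≤n deg fₘ ≤ r_{ρ−1}(f₁) + r_{ρ−1}(f₂) + ⋯ + r_{ρ−1}(fₙ) − ρ(ρ−1)/2. -/
open Polynomial

/-- The radical of `g`: product of the distinct monic linear factors of `g`. -/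
noncomputable def rad (g : ℂ[X]) : ℂ[X] := ∏ a ∈ g.roots.toFinset, (X - C a)

/-- `radE e g = gcd (g, rad(g)^e)`, the `(e+1)`-th-power-free part of `g`. -/
noncomputable def radE (e : ℕ) (g : ℂ[X]) : ℂ[X] := EuclideanDomain.gcd g (rad g ^ e)

/-- `rE e g` is the degree of `radE e g`. -/
noncomputable def rE (e : ℕ) (g : ℂ[X]) : ℕ := (radE e g).natDegree


lemma natDegree_eq_sumZ (f : ℂ[X]) (Z : Finset ℂ) (hZ : f.roots.toFinset ⊆ Z) :
    f.natDegree = ∑ a ∈ Z, f.rootMultiplicity a := by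
  have h1 : f.roots.card = f.natDegree :=
    (IsAlgClosed.splits f).natDegree_eq_card_roots.symm
  rw [← h1, ← Multiset.toFinset_sum_count_eq]
  simp only [count_roots]
  apply Finset.sum_subset hZ
  intro a _ ha
  rw [← count_roots]
  exact Multiset.count_eq_zero.2 (fun h => ha (Multiset.mem_toFinset.2 h))

lemma rad_ne_zero (g : ℂ[X]) : rad g ≠ 0 := by
  unfold rad
  exact Finset.prod_ne_zero_iff.2 (fun a _ => X_sub_C_ne_zero a)

lemma rootMult_gcd (p q : ℂ[X]) (hp : p ≠ 0) (hq : q ≠ 0) (a : ℂ) :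
    (EuclideanDomain.gcd p q).rootMultiplicity a
      = min (p.rootMultiplicity a) (q.rootMultiplicity a) := by
  have hg : EuclideanDomain.gcd p q ≠ 0 := fun h => hp (EuclideanDomain.gcd_eq_zero_iff.1 h).1
  apply le_antisymm
  · apply le_min
    · rw [le_rootMultiplicity_iff hp]
      exact (pow_rootMultiplicity_dvd _ a).trans (EuclideanDomain.gcd_dvd_left p q)
    · rw [le_rootMultiplicity_iff hq]
      exact (pow_rootMultiplicity_dvd _ a).trans (EuclideanDomain.gcd_dvd_right p q)
  · rw [le_rootMultiplicity_iff hg]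
    apply EuclideanDomain.dvd_gcd
    · rw [← le_rootMultiplicity_iff hp]; exact min_le_left _ _
    · rw [← le_rootMultiplicity_iff hq]; exact min_le_right _ _

lemma rootMult_pow (p : ℂ[X]) (a : ℂ) (e : ℕ) :
    (p ^ e).rootMultiplicity a = e * p.rootMultiplicity a := by
  rw [← count_roots, ← count_roots, roots_pow, Multiset.count_nsmul]

lemma rootMult_radE (e : ℕ) (g : ℂ[X]) (hg : g ≠ 0) (a : ℂ) :
    (radE e g).rootMultiplicity a = min (g.rootMultiplicity a) e := by
  unfold radE
  rw [rootMult_gcd _ _ hg (pow_ne_zero _ (rad_ne_zero g)), rootMult_pow]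
  have h : (rad g).rootMultiplicity a = if a ∈ g.roots.toFinset then 1 else 0 := by
    rw [← count_roots]
    unfold rad
    rw [roots_prod_X_sub_C]
    split_ifs with h
    · exact Multiset.count_eq_one_of_mem (Finset.nodup _) h
    · exact Multiset.count_eq_zero.2 h
  rw [h]
  split_ifs with h
  · simp
  · have : g.rootMultiplicity a = 0 := by
      rw [← count_roots]
      exact Multiset.count_eq_zero.2 (fun h' => h (Multiset.mem_toFinset.2 h'))
    simp [this]

lemma rE_eq_sumZ (e : ℕ) (f : ℂ[X]) (hf : f ≠ 0) (Z : Finset ℂ) (hZ : f.roots.toFinset ⊆ Z) :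
    rE e f = ∑ a ∈ Z, min (f.rootMultiplicity a) e := by
  unfold rE
  rw [natDegree_eq_sumZ _ Z]
  · exact Finset.sum_congr rfl (fun a _ => rootMult_radE e f hf a)
  · refine subset_trans ?_ hZ
    intro a ha
    rw [Multiset.mem_toFinset] at *
    exact Multiset.mem_of_le (roots.le_of_dvd hf (EuclideanDomain.gcd_dvd_left _ _)) ha

/-- Common support finset. -/
lemma exists_Z {ι : Type} [Fintype ι] (f : ι → ℂ[X]) :
    ∃ Z : Finset ℂ, ∀ i, (f i).roots.toFinset ⊆ Z := by
  classical
  exact ⟨Finset.univ.biUnion (fun i => (f i).roots.toFinset),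
    fun i => Finset.subset_biUnion_of_mem (fun i => (f i).roots.toFinset) (Finset.mem_univ i)⟩

lemma rE_mono_dvd (e e' : ℕ) (he : e ≤ e') (f g : ℂ[X]) (hg : g ≠ 0) (h : f ∣ g) :
    rE e f ≤ rE e' g := by
  have hf : f ≠ 0 := fun h0 => hg (by rw [h0] at h; exact zero_dvd_iff.1 h)
  rw [rE_eq_sumZ e f hf g.roots.toFinset, rE_eq_sumZ e' g hg _ subset_rfl]
  · apply Finset.sum_le_sum
    intro a _
    have := rootMultiplicity_le_rootMultiplicity_of_dvd hg h a
    omega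
  · exact Multiset.toFinset_subset.2 (Multiset.subset_of_le (roots.le_of_dvd hg h))

lemma exists_gcd_extract {ι : Type} [Fintype ι] (f : ι → ℂ[X]) (i0 : ι) (h0 : f i0 ≠ 0) :
    ∃ (g : ℂ[X]) (k : ι → ℂ[X]), g ≠ 0 ∧ (∀ i, f i = g * k i) ∧
      ∀ a, ∃ i, (k i).eval a ≠ 0 := by
  obtain ⟨g, hg⟩ := IsPrincipalIdealRing.principal (Ideal.span (Set.range f))
  have hdvd : ∀ i, g ∣ f i := by
    intro i
    have : f i ∈ Ideal.span (Set.range f) := Ideal.subset_span ⟨i, rfl⟩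
    rw [hg] at this
    exact Ideal.mem_span_singleton.1 this
  choose k hk using hdvd
  have hg0 : g ≠ 0 := by
    rintro rfl
    exact h0 (by rw [hk i0, zero_mul])
  refine ⟨g, k, hg0, hk, ?_⟩
  intro a
  by_contra! hcon
  have hmem : g ∈ Ideal.span (Set.range f) := by
    rw [hg]; exact Ideal.mem_span_singleton_self g
  obtain ⟨c, hc⟩ := (Submodule.mem_span_range_iff_exists_fun _).1 hmem
  have h1 : g * (∑ i, c i * k i) = g * 1 := by
    rw [Finset.mul_sum, mul_one]
    conv_rhs => rw [← hc]
    apply Finset.sum_congr rfl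
    intro i _
    rw [hk i, smul_eq_mul]; ring
  have h2 := congrArg (eval a) (mul_left_cancel₀ hg0 h1)
  simp [eval_finsetSum, hcon] at h2

/-- Nonvanishing of the Wronskian. -/
lemma wronskian_ne_zero (r : ℕ) (h : Fin r → ℂ[X]) (hli : LinearIndependent ℂ h) :
    (Matrix.of (fun k i : Fin r => derivative^[(k : ℕ)] (h i))).det ≠ 0 := by
  classical
  intro hdet
  obtain ⟨u, hu0, hu⟩ := Matrix.exists_vecMul_eq_zero_iff.2 hdet
  -- last nonzero coefficient
  obtain ⟨s, hs, hsmax⟩ : ∃ s : Fin r, u s ≠ 0 ∧ ∀ k, s < k → u k = 0 := by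
    have hne : (Finset.univ.filter (fun k => u k ≠ 0)).Nonempty := by
      obtain ⟨k, hk⟩ := Function.ne_iff.1 hu0
      exact ⟨k, by simpa using hk⟩
    refine ⟨_, (Finset.mem_filter.1 (Finset.max'_mem _ hne)).2, ?_⟩
    intro k hk
    by_contra hk'
    exact absurd (Finset.le_max' _ k (by simpa using hk')) (not_le.2 hk)
  obtain ⟨a, ha⟩ : ∃ a, (u s).eval a ≠ 0 := by
    by_contra! hcon
    exact hs (Polynomial.funext (by simpa using hcon))
  -- a combination with vanishing jet
  let φ : (Fin r → ℂ) →ₗ[ℂ] (Fin (s : ℕ) → ℂ) :=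
    { toFun := fun c k => ∑ i, c i * (derivative^[(k : ℕ)] (h i)).eval a
      map_add' := by intro x y; ext k; simp [add_mul, Finset.sum_add_distrib]
      map_smul' := by intro x y; ext k; simp [Finset.mul_sum, mul_assoc] }
  have hker : LinearMap.ker φ ≠ ⊥ := by
    apply LinearMap.ker_ne_bot_of_finrank_lt
    simp
  obtain ⟨c, hcker, hc0⟩ := (Submodule.ne_bot_iff _).1 hker
  set F : ℂ[X] := ∑ i, c i • h i with hF
  have hF0 : F ≠ 0 := by
    intro hz
    apply hc0
    ext i
    exact Fintype.linearIndependent_iff.1 hli c hz i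
  have hder : ∀ k : ℕ, derivative^[k] F = ∑ i, c i • derivative^[k] (h i) := by
    intro k
    rw [hF, iterate_derivative_sum]
    exact Finset.sum_congr rfl (fun i _ => iterate_derivative_smul _ _ _)
  have hjet : ∀ k : ℕ, k < s → (derivative^[k] F).eval a = 0 := by
    intro k hk
    have := congrFun (LinearMap.mem_ker.1 hcker) ⟨k, hk⟩
    rw [hder, eval_finsetSum]
    simpa [φ] using this
  have hode : ∑ k, u k * derivative^[(k : ℕ)] F = 0 := by
    simp only [hder, Finset.mul_sum]
    rw [Finset.sum_comm]
    apply Finset.sum_eq_zero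
    intro i _
    have := congrFun hu i
    simp only [Matrix.vecMul, dotProduct, Matrix.of_apply, Pi.zero_apply] at this
    simp only [mul_smul_comm]
    rw [← Finset.smul_sum, this, smul_zero]
  have hm : (s : ℕ) ≤ F.rootMultiplicity a := by
    rcases Nat.eq_zero_or_pos (s : ℕ) with h0 | h0
    · omega
    · have := (lt_rootMultiplicity_iff_isRoot_iterate_derivative (n := (s : ℕ) - 1) (t := a) hF0).2
        (fun m hm => hjet m (by omega))
      omega
  set m := F.rootMultiplicity a with hmdef
  have hdv : ∀ k : ℕ, (X - C a) ^ (m - k) ∣ derivative^[k] F := by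
    intro k
    exact pow_sub_dvd_iterate_derivative_of_pow_dvd k (pow_rootMultiplicity_dvd F a)
  have hdvs : (X - C a) ^ (m - s + 1) ∣ u s * derivative^[(s : ℕ)] F := by
    have h1 : u s * derivative^[(s : ℕ)] F
        = - ∑ k ∈ Finset.univ.erase s, u k * derivative^[(k : ℕ)] F := by
      rw [eq_neg_iff_add_eq_zero,
        Finset.add_sum_erase _ (fun k : Fin r => u k * derivative^[(k : ℕ)] F) (Finset.mem_univ s)]
      exact hode
    rw [h1, dvd_neg]
    apply Finset.dvd_sum
    intro k hk
    rcases lt_or_gt_of_ne (Finset.ne_of_mem_erase hk) with hlt | hgt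
    · apply Dvd.dvd.mul_left
      exact (pow_dvd_pow _ (by have : (k : ℕ) < s := hlt; omega)).trans (hdv k)
    · rw [hsmax k hgt, zero_mul]; exact dvd_zero _
  have hcop : IsCoprime ((X - C a) ^ (m - s + 1)) (u s) := by
    apply IsCoprime.pow_left
    rw [(irreducible_X_sub_C a).coprime_iff_not_dvd, dvd_iff_isRoot]
    exact ha
  have hfin := hcop.dvd_of_dvd_mul_left hdvs
  -- contradiction with the (m-s)-th further derivative
  have h2 : (derivative^[m - s] (derivative^[(s : ℕ)] F)).IsRoot a := by
    have := pow_sub_dvd_iterate_derivative_of_pow_dvd (m - s) hfin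
    rw [← dvd_iff_isRoot]
    simpa using this
  rw [← Function.iterate_add_apply, Nat.sub_add_cancel hm] at h2
  have h3 : m < F.rootMultiplicity a := by
    rw [lt_rootMultiplicity_iff_isRoot_iterate_derivative hF0]
    intro j hj
    rcases hj.lt_or_eq with hlt | rfl
    · exact (lt_rootMultiplicity_iff_isRoot_iterate_derivative
        (n := m - 1) (t := a) hF0).1 (by omega) j (by omega)
    · exact h2
  omega

lemma dvd_det_of_col (r : ℕ) (M : Matrix (Fin r) (Fin r) ℂ[X]) (p : ℂ[X]) (e : Fin r → ℕ)
    (h : ∀ k i, p ^ e i ∣ M k i) : p ^ (∑ i, e i) ∣ M.det := by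
  rw [Matrix.det_apply]
  apply Finset.dvd_sum
  intro σ _
  rw [Units.smul_def]
  apply dvd_smul_of_dvd
  rw [← Finset.prod_pow_eq_pow_sum]
  exact Finset.prod_dvd_prod_of_dvd _ _ (fun i _ => h _ i)

lemma natDegree_det_le (r : ℕ) (M : Matrix (Fin r) (Fin r) ℂ[X]) (e : Fin r → ℕ)
    (h : ∀ k i, (M k i).natDegree ≤ e i) : M.det.natDegree ≤ ∑ i, e i := by
  rw [Matrix.det_apply]
  apply natDegree_sum_le_of_forall_le
  intro σ _
  rw [Units.smul_def]
  refine (natDegree_smul_le _ _).trans ?_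
  refine (natDegree_prod_le _ _).trans ?_
  exact Finset.sum_le_sum (fun i _ => h _ i)

lemma natDegree_X_pow_mul_deriv (p : ℂ[X]) (k : ℕ) :
    (X ^ k * derivative^[k] p).natDegree ≤ p.natDegree := by
  rcases lt_or_ge p.natDegree k with h | h
  · rw [iterate_derivative_eq_zero h]; simp
  · refine natDegree_mul_le.trans ?_
    rw [natDegree_X_pow]
    have := natDegree_iterate_derivative p k
    omega

lemma circuit_fin (r : ℕ) (h : Fin (r + 1) → ℂ[X]) (hne : ∀ i, h i ≠ 0)
    (hli : LinearIndependent ℂ (fun i : Fin r => h i.succ)) (hsum : ∑ i, h i = 0)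
    (hco : ∀ a, ∃ i, (h i).eval a ≠ 0) :
    (h 0).natDegree + r * (r - 1) / 2 ≤ ∑ i, rE (r - 1) (h i) := by
  classical
  set M : Matrix (Fin r) (Fin r) ℂ[X] :=
    Matrix.of (fun k i : Fin r => derivative^[(k : ℕ)] (h i.succ)) with hM
  have hW : M.det ≠ 0 := wronskian_ne_zero r _ hli
  -- degree bound
  have hdeg : M.det.natDegree + r * (r - 1) / 2 ≤ ∑ i : Fin r, (h i.succ).natDegree := by
    have h1 : (Matrix.of fun k i : Fin r => (X : ℂ[X]) ^ (k : ℕ) * M k i).det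
        = X ^ (r * (r - 1) / 2) * M.det := by
      rw [Matrix.det_mul_column, Finset.prod_pow_eq_pow_sum,
        Fin.sum_univ_eq_sum_range (fun i => i), Finset.sum_range_id]
    have h2 := natDegree_det_le r (Matrix.of fun k i : Fin r => (X : ℂ[X]) ^ (k : ℕ) * M k i)
      (fun i => (h i.succ).natDegree) (fun k i => natDegree_X_pow_mul_deriv _ _)
    rw [h1, natDegree_mul (pow_ne_zero _ X_ne_zero) hW, natDegree_X_pow] at h2
    omega
  -- local bound
  have hloc : ∀ a, ∑ i, ((h i).rootMultiplicity a - (r - 1)) ≤ M.det.rootMultiplicity a := by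
    intro a
    have hd : ∀ (k : Fin r) (i : Fin (r + 1)),
        (X - C a) ^ ((h i).rootMultiplicity a - (r - 1)) ∣ derivative^[(k : ℕ)] (h i) := by
      intro k i
      refine (pow_dvd_pow _ ?_).trans
        (pow_sub_dvd_iterate_derivative_of_pow_dvd (k : ℕ) (pow_rootMultiplicity_dvd (h i) a))
      have := k.2
      omega
    rw [le_rootMultiplicity_iff hW]
    obtain ⟨j, hj⟩ := hco a
    have hj0 : (h j).rootMultiplicity a = 0 := rootMultiplicity_eq_zero hj
    induction j using Fin.cases with
    | zero =>
      rw [Fin.sum_univ_succ, hj0, Nat.zero_sub, zero_add]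
      exact dvd_det_of_col r M _ _ (fun k i => hd k i.succ)
    | succ j =>
      have hdet : (M.updateCol j (fun k => derivative^[(k : ℕ)] (h 0))).det = - M.det := by
        have h1 : (fun k : Fin r => derivative^[(k : ℕ)] (h 0))
            = fun k => ∑ i, (fun _ : Fin r => (-1 : ℂ[X])) i • M k i := by
          ext1 k
          have h0 : h 0 = - ∑ i : Fin r, h i.succ := by
            rw [eq_neg_iff_add_eq_zero, ← Fin.sum_univ_succ]; exact hsum
          rw [h0, iterate_derivative_neg, iterate_derivative_sum]
          simp [hM]
        rw [h1, Matrix.det_updateCol_sum]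
        simp
      have h2 := dvd_det_of_col r (M.updateCol j (fun k => derivative^[(k : ℕ)] (h 0))) (X - C a)
        (fun i => if i = j then (h 0).rootMultiplicity a - (r - 1)
          else (h i.succ).rootMultiplicity a - (r - 1)) (by
            intro k i
            by_cases hij : i = j
            · subst hij; simpa using hd k 0
            · simpa [hij, hM] using hd k i.succ)
      rw [hdet, dvd_neg] at h2
      convert h2 using 2
      rw [Fin.sum_univ_succ, ← Finset.add_sum_erase _ _ (Finset.mem_univ j),
        ← Finset.add_sum_erase _ _ (Finset.mem_univ j), hj0]
      simp only [if_true, Nat.zero_sub, zero_add]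
      congr 1
      apply Finset.sum_congr rfl
      intro i hi
      rw [if_neg (Finset.ne_of_mem_erase hi)]
  -- sum
  obtain ⟨Z, hZ⟩ := exists_Z (fun o : Option (Fin (r + 1)) => o.elim M.det h)
  have hZW := natDegree_eq_sumZ _ Z (hZ none)
  have hZi := fun i => natDegree_eq_sumZ _ Z (hZ (some i))
  have hZr := fun i => rE_eq_sumZ (r - 1) _ (hne i) Z (hZ (some i))
  simp only [Option.elim] at hZW hZi
  have key : ∑ i, (h i).natDegree ≤ M.det.natDegree + ∑ i, rE (r - 1) (h i) := by
    rw [hZW]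
    simp only [hZi, hZr]
    rw [Finset.sum_comm, Finset.sum_comm (s := Finset.univ), ← Finset.sum_add_distrib]
    apply Finset.sum_le_sum
    intro a _
    refine le_trans ?_ (Nat.add_le_add_right (hloc a) _)
    rw [← Finset.sum_add_distrib]
    apply Finset.sum_le_sum
    intro i _
    omega
  rw [Fin.sum_univ_succ] at key
  omega

lemma circuit_gen {κ : Type} [Fintype κ] [DecidableEq κ] (r : ℕ) (hcard : Fintype.card κ = r + 1)
    (h : κ → ℂ[X]) (hne : ∀ i, h i ≠ 0)
    (hli : ∀ j : κ, LinearIndependent ℂ (fun i : {i : κ // i ≠ j} => h i))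
    (c : κ → ℂ) (hc : ∀ i, c i ≠ 0) (hsum : ∑ i, c i • h i = 0)
    (hco : ∀ a, ∃ i, (h i).eval a ≠ 0) (m : κ) :
    (h m).natDegree + r * (r - 1) / 2 ≤ ∑ i, rE (r - 1) (h i) := by
  classical
  let e0 : κ ≃ Fin (r + 1) := Fintype.equivFinOfCardEq hcard
  let e : Fin (r + 1) ≃ κ := (e0.trans (Equiv.swap (e0 m) 0)).symm
  have he : e 0 = m := by simp [e]
  have hrE : ∀ i, rE (r - 1) (c i • h i) = rE (r - 1) (h i) := by
    intro i
    have hci : c i • h i ≠ 0 := smul_ne_zero (hc i) (hne i)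
    apply le_antisymm
    · apply rE_mono_dvd _ _ le_rfl _ _ (hne i)
      exact ⟨C (c i)⁻¹, by rw [smul_eq_C_mul, mul_right_comm, ← C_mul, mul_inv_cancel₀ (hc i)]; simp⟩
    · apply rE_mono_dvd _ _ le_rfl _ _ hci
      exact ⟨C (c i), by rw [smul_eq_C_mul, mul_comm]⟩
  have main := circuit_fin r (fun i => c (e i) • h (e i))
    (fun i => smul_ne_zero (hc _) (hne _)) ?_ ?_ ?_
  · simp only [he, hrE] at main
    rw [natDegree_smul_of_smul_regular _ (IsSMulRegular.of_ne_zero (hc m))] at main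
    rwa [e.sum_comp (fun i => rE (r - 1) (h i))] at main
  · have h1 : LinearIndependent ℂ (fun i : Fin r => h (e i.succ)) := by
      have := (hli m).comp (fun i : Fin r => (⟨e i.succ, by
        rw [← he]; exact fun h => Fin.succ_ne_zero i (e.injective h)⟩ : {i // i ≠ m})) (by
        intro i j hij
        have := congrArg Subtype.val hij
        exact Fin.succ_injective _ (e.injective this))
      exact this
    exact h1.units_smul (fun i => Units.mk0 (c (e i.succ)) (hc _))
  · rw [e.sum_comp (fun i => c i • h i)]; exact hsum
  · intro a
    obtain ⟨i, hi⟩ := hco a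
    refine ⟨e.symm i, ?_⟩
    simp [hc, hi]

lemma local_three (T : ℕ) (g γ k0 k' : ℂ[X]) (hg : g ≠ 0) (hγ : γ ≠ 0) (hk0 : k0 ≠ 0)
    (hk' : k' ≠ 0) (heq : γ * k0 = g * k') (hcop : ∀ a, g.eval a ≠ 0 ∨ γ.eval a ≠ 0) :
    rE T k0 + g.natDegree ≤ rE T g + k0.natDegree := by
  obtain ⟨Z, hZ⟩ := exists_Z ![g, k0]
  have hZg := hZ 0
  have hZk := hZ 1
  simp only [Matrix.cons_val_zero, Matrix.cons_val_one] at hZg hZk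
  rw [rE_eq_sumZ T k0 hk0 Z hZk, rE_eq_sumZ T g hg Z hZg, natDegree_eq_sumZ g Z hZg,
    natDegree_eq_sumZ k0 Z hZk, ← Finset.sum_add_distrib, ← Finset.sum_add_distrib]
  apply Finset.sum_le_sum
  intro a _
  have h1 := rootMultiplicity_mul (x := a) (mul_ne_zero hγ hk0)
  have h2 := rootMultiplicity_mul (x := a) (mul_ne_zero hg hk')
  rw [heq] at h1
  rcases hcop a with h | h
  · have := rootMultiplicity_eq_zero (p := g) (x := a) h
    omega
  · have := rootMultiplicity_eq_zero (p := γ) (x := a) h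
    omega

lemma local_four {κ : Type} [Fintype κ] [DecidableEq κ] (T : ℕ) (g : ℂ[X]) (f h : κ → ℂ[X])
    (hg : g ≠ 0) (hne : ∀ i, f i ≠ 0) (hf : ∀ i, f i = g * h i)
    (hco : ∀ a, ∃ i, (h i).eval a ≠ 0) :
    rE T g + ∑ i, rE T (h i) ≤ ∑ i, rE T (f i) := by
  have hh : ∀ i, h i ≠ 0 := fun i h0 => hne i (by rw [hf, h0, mul_zero])
  obtain ⟨i0, _⟩ := hco 0
  obtain ⟨Z, hZ⟩ := exists_Z f
  have hsub : ∀ p i, p ∣ f i → p.roots.toFinset ⊆ Z := fun p i hp =>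
    (Multiset.toFinset_subset.2 (Multiset.subset_of_le (roots.le_of_dvd (hne i) hp))).trans (hZ i)
  rw [rE_eq_sumZ T g hg Z (hsub g i0 ⟨_, hf i0⟩)]
  have h1 := fun i => rE_eq_sumZ T (h i) (hh i) Z (hsub (h i) i ⟨g, by rw [hf, mul_comm]⟩)
  have h2 := fun i => rE_eq_sumZ T (f i) (hne i) Z (hZ i)
  simp only [h1, h2]
  rw [Finset.sum_comm, Finset.sum_comm (s := Finset.univ) (t := Z), ← Finset.sum_add_distrib]
  apply Finset.sum_le_sum
  intro a _
  have hm : ∀ i, (f i).rootMultiplicity a = g.rootMultiplicity a + (h i).rootMultiplicity a := by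
    intro i
    rw [hf i]
    exact rootMultiplicity_mul (mul_ne_zero hg (hh i))
  obtain ⟨j, hj⟩ := hco a
  have hj0 := rootMultiplicity_eq_zero (p := h j) (x := a) hj
  rw [← Finset.add_sum_erase _ _ (Finset.mem_univ j),
    ← Finset.add_sum_erase _ (fun i => min ((f i).rootMultiplicity a) T) (Finset.mem_univ j)]
  have h3 : ∑ i ∈ Finset.univ.erase j, min ((h i).rootMultiplicity a) T
      ≤ ∑ i ∈ Finset.univ.erase j, min ((f i).rootMultiplicity a) T := by
    apply Finset.sum_le_sum
    intro i _
    have := hm i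
    omega
  have := hm j
  simp only [hj0]
  omega

lemma tri_mono (a b : ℕ) (h : a ≤ b) : a * (a - 1) / 2 ≤ b * (b - 1) / 2 :=
  Nat.div_le_div_right (Nat.mul_le_mul h (by omega))

lemma finrank_span_mul {κ : Type} [Fintype κ] (γ : ℂ[X]) (hγ : γ ≠ 0) (F k : κ → ℂ[X])
    (h : ∀ i, F i = γ * k i) :
    Module.finrank ℂ (Submodule.span ℂ (Set.range k))
      = Module.finrank ℂ (Submodule.span ℂ (Set.range F)) := by
  have h1 : Submodule.span ℂ (Set.range F)
      = (Submodule.span ℂ (Set.range k)).map (LinearMap.mulLeft ℂ γ) := by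
    rw [Submodule.map_span, ← Set.range_comp]
    congr 2
    ext1 i
    exact h i
  rw [h1]
  exact (Submodule.equivMapOfInjective (LinearMap.mulLeft ℂ γ)
    (fun a b hab => mul_left_cancel₀ hγ hab) (Submodule.span ℂ (Set.range k))).finrank_eq

/-- A minimal dependent subfamily together with its relation. -/
lemma exists_circuit {ι : Type} [Fintype ι] [DecidableEq ι] (f : ι → ℂ[X]) (hne : ∀ i, f i ≠ 0)
    (hnon : Nonempty ι) (hsum : ∑ i, f i = 0) :
    ∃ (A : Finset ι) (r : ℕ) (c : ι → ℂ), 1 ≤ r ∧ A.card = r + 1 ∧ (∀ i ∈ A, c i ≠ 0) ∧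
      ∑ i ∈ A, c i • f i = 0 ∧ ∀ j ∈ A, LinearIndepOn ℂ f (A.erase j : Finset ι) := by
  obtain ⟨A, hA⟩ := exists_minimal_of_wellFoundedLT
    (fun A : Finset ι => ¬ LinearIndepOn ℂ f (A : Set ι)) ⟨Finset.univ, by
      rw [linearIndepOn_finset_iff]
      intro h
      obtain ⟨i⟩ := hnon
      exact one_ne_zero (h (fun _ => (1 : ℂ)) (by simpa using hsum) i (Finset.mem_univ i))⟩
  have hmin : ∀ j ∈ A, LinearIndepOn ℂ f (A.erase j : Finset ι) := by
    intro j hj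
    by_contra hcon
    exact hA.not_prop_of_lt (Finset.erase_ssubset hj) hcon
  have hdep := hA.prop
  rw [linearIndepOn_finset_iff] at hdep
  push Not at hdep
  obtain ⟨c, hc, i0, hi0, hci0⟩ := hdep
  have hcne : ∀ i ∈ A, c i ≠ 0 := by
    intro j hj hcj
    have h1 := linearIndepOn_finset_iff.1 (hmin j hj) c (by
      rw [← Finset.add_sum_erase _ _ hj, hcj, zero_smul, zero_add] at hc
      exact hc) i0
    refine hci0 (h1 (Finset.mem_erase.2 ⟨?_, hi0⟩))
    rintro rfl
    exact hci0 hcj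
  have hcard : 2 ≤ A.card := by
    by_contra hlt
    have h1 : A.card = 1 := by
      have := Finset.card_pos.2 ⟨i0, hi0⟩
      omega
    obtain ⟨j, rfl⟩ := Finset.card_eq_one.1 h1
    rw [Finset.sum_singleton] at hc
    exact smul_ne_zero (hcne j (by simp)) (hne j) hc
  exact ⟨A, A.card - 1, c, by omega, by omega, hcne, hc, hmin⟩

lemma main_ind (n : ℕ) : ∀ (ι : Type) [Fintype ι] [DecidableEq ι] (f : ι → ℂ[X]),
    Fintype.card ι ≤ n → (∀ i, f i ≠ 0) →
    2 ≤ Module.finrank ℂ (Submodule.span ℂ (Set.range f)) →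
    (∀ a, ∃ i, (f i).eval a ≠ 0) → ∑ i, f i = 0 →
    (∀ S : Finset ι, S.Nonempty → S ≠ Finset.univ → ∑ i ∈ S, f i ≠ 0) →
    ∃ ρ : ℕ, 2 ≤ ρ ∧ ρ ≤ Module.finrank ℂ (Submodule.span ℂ (Set.range f)) ∧
      ∀ m, (f m).natDegree + ρ * (ρ - 1) / 2 ≤ ∑ i, rE (ρ - 1) (f i) := by
  classical
  induction n with
  | zero =>
    intro ι _ _ f hcard _ _ hco
    obtain ⟨i, _⟩ := hco 0
    have := Fintype.card_pos_iff.2 ⟨i⟩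
    omega
  | succ n ih =>
  intro ι _ _ f hcard hne hrank hco hsum hsub
  have hnon : Nonempty ι := ⟨(hco 0).choose⟩
  obtain ⟨A, r, c, hr, hA, hc, hcs, hli⟩ := exists_circuit f hne hnon hsum
  obtain ⟨j0, hj0⟩ : A.Nonempty := Finset.card_pos.1 (by omega)
  obtain ⟨g, h, hg, hfh, hhco⟩ := exists_gcd_extract (fun i : A => f i) ⟨j0, hj0⟩ (hne j0)
  have hh : ∀ i, h i ≠ 0 := fun i h0 => hne i (by rw [hfh, h0, mul_zero])
  -- inequality for the circuit
  have hcirc : ∀ m, (h m).natDegree + r * (r - 1) / 2 ≤ ∑ i, rE (r - 1) (h i) := by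
    apply circuit_gen r (by simpa using hA) h hh ?_ (fun i => c i) (fun i => hc i i.2) ?_ hhco
    · intro j
      have h1 := (hli j j.2).comp (fun i : {i : A // i ≠ j} =>
        (⟨i.1.1, Finset.mem_coe.2 (Finset.mem_erase.2
          ⟨fun hij => i.2 (Subtype.ext hij), i.1.2⟩)⟩ : ((A.erase j : Finset ι) : Set ι))) (by
          intro x y hxy
          have := congrArg Subtype.val hxy
          exact Subtype.ext (Subtype.ext this))
      apply LinearIndependent.of_comp (LinearMap.mulLeft ℂ g)
      have h2 : (⇑(LinearMap.mulLeft ℂ g) ∘ fun i : {i : A // i ≠ j} => h i)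
          = fun i : {i : A // i ≠ j} => f i.1 := by
        ext1 i
        exact (hfh i.1).symm
      rw [h2]
      exact h1
    · apply mul_left_cancel₀ hg
      rw [mul_zero, Finset.mul_sum, ← hcs, ← Finset.sum_coe_sort A]
      apply Finset.sum_congr rfl
      intro i _
      rw [hfh i, mul_smul_comm]
  -- the span of the circuit
  set S : Submodule ℂ ℂ[X] := Submodule.span ℂ (f '' (A : Set ι)) with hS
  have hAS : ∀ i ∈ A, f i ∈ S := fun i hi => Submodule.subset_span ⟨i, hi, rfl⟩
  have hSle : S ≤ Submodule.span ℂ (Set.range f) :=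
    Submodule.span_mono (Set.image_subset_range _ _)
  have hfin : FiniteDimensional ℂ (Submodule.span ℂ (Set.range f)) :=
    FiniteDimensional.span_of_finite ℂ (Set.finite_range f)
  have hcardj : (A.erase j0).card = r := by rw [Finset.card_erase_of_mem hj0]; omega
  have hrd : r ≤ Module.finrank ℂ (Submodule.span ℂ (Set.range f)) := by
    have h1 := finrank_span_eq_card (hli j0 hj0)
    have h2 : Submodule.span ℂ (Set.range fun i : ((A.erase j0 : Finset ι) : Set ι) => f i)
      ≤ Submodule.span ℂ (Set.range f) :=
      Submodule.span_mono (by rintro _ ⟨i, rfl⟩; exact ⟨i, rfl⟩)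
    have h3 := Submodule.finrank_mono h2
    rw [h1] at h3
    have h4 : Fintype.card ((A.erase j0 : Finset ι) : Set ι) = r := by
      rw [← hcardj]; exact Fintype.card_coe _
    omega
  have hSr : Module.finrank ℂ S ≤ r := by
    have h1 : S ≤ Submodule.span ℂ (((A.erase j0).image f : Finset ℂ[X]) : Set ℂ[X]) := by
      rw [hS, Submodule.span_le]
      have hmem : ∀ i ∈ A.erase j0,
          f i ∈ Submodule.span ℂ (((A.erase j0).image f : Finset ℂ[X]) : Set ℂ[X]) :=
        fun i hi => Submodule.subset_span (Finset.mem_coe.2 (Finset.mem_image_of_mem f hi))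
      rintro _ ⟨i, hi, rfl⟩
      by_cases hij : i = j0
      · subst hij
        have h2 : f i = (c i)⁻¹ • (- ∑ k ∈ A.erase i, c k • f k) := by
          rw [← Finset.add_sum_erase _ _ hj0] at hcs
          rw [← eq_neg_of_add_eq_zero_left hcs, smul_smul, inv_mul_cancel₀ (hc i hj0), one_smul]
        rw [h2]
        exact Submodule.smul_mem _ _ (Submodule.neg_mem _ (Submodule.sum_mem _
          (fun k hk => Submodule.smul_mem _ _ (hmem k hk))))
      · exact hmem i (Finset.mem_erase.2 ⟨hij, hi⟩)
    have h2 := Submodule.finrank_mono h1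
    have h3 := finrank_span_finset_le_card (R := ℂ) ((A.erase j0).image f)
    unfold Set.finrank at h3
    have h4 := Finset.card_image_le (s := A.erase j0) (f := f)
    omega
  -- a maximal degree element
  obtain ⟨m', -, hm'⟩ := Finset.exists_max_image (Finset.univ : Finset A)
    (fun i => (h i).natDegree) ⟨⟨j0, hj0⟩, Finset.mem_univ _⟩
  have hSp : ∀ p ∈ S, g ∣ p ∧ p.natDegree ≤ g.natDegree + (h m').natDegree := by
    intro p hp
    induction hp using Submodule.span_induction with
    | mem x hx =>
      obtain ⟨i, hi, rfl⟩ := hx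
      have h1 := hfh ⟨i, hi⟩
      simp only [] at h1
      refine ⟨⟨_, h1⟩, ?_⟩
      rw [h1]
      exact natDegree_mul_le.trans (Nat.add_le_add_left (hm' _ (Finset.mem_univ _)) _)
    | zero => simp
    | add x y _ _ hx hy =>
      exact ⟨dvd_add hx.1 hy.1, (natDegree_add_le _ _).trans (max_le hx.2 hy.2)⟩
    | smul t x _ hx =>
      exact ⟨dvd_smul_of_dvd t hx.1, (natDegree_smul_le _ _).trans hx.2⟩
  have hcm := hcirc m'
  by_cases hB : ∀ i, f i ∈ S
  · -- everything is in the span of the circuit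
    have hle : Submodule.span ℂ (Set.range f) ≤ S := by
      rw [Submodule.span_le]
      rintro _ ⟨i, rfl⟩
      exact hB i
    have hSfin : FiniteDimensional ℂ S :=
      FiniteDimensional.span_of_finite ℂ ((A.finite_toSet).image f)
    have h2r := Submodule.finrank_mono hle
    refine ⟨r, by omega, hrd, ?_⟩
    intro m
    have hg0 : g.natDegree = 0 := by
      by_contra h0
      obtain ⟨a, ha⟩ := IsAlgClosed.exists_root g (fun hd => h0 (natDegree_eq_of_degree_eq_some hd))
      obtain ⟨i, hi⟩ := hco a
      obtain ⟨q, hq⟩ := (hSp _ (hB i)).1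
      apply hi
      rw [hq, eval_mul, ha.eq_zero, zero_mul]
    have h1 := (hSp _ (hB m)).2
    have h2 : ∑ i, rE (r - 1) (h i) ≤ ∑ i : A, rE (r - 1) (f i) :=
      Finset.sum_le_sum (fun i _ => rE_mono_dvd _ _ le_rfl _ _ (hne i) ⟨g, by rw [hfh, mul_comm]⟩)
    rw [Finset.sum_coe_sort A (fun i => rE (r - 1) (f i))] at h2
    have h3 : ∑ i ∈ A, rE (r - 1) (f i) ≤ ∑ i, rE (r - 1) (f i) :=
      Finset.sum_le_sum_of_subset (Finset.subset_univ A)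
    omega
  · push Not at hB
    obtain ⟨b0, hb0⟩ := hB
    let π : ι → Option {i // f i ∉ S} := fun i => if hi : f i ∈ S then none else some ⟨i, hi⟩
    have hπn : ∀ i, π i = none ↔ f i ∈ S := by
      intro i; simp only [π]; split_ifs with hi <;> simp [hi]
    have hπs : ∀ i b, π i = some b ↔ i = b.1 := by
      intro i b
      simp only [π]
      split_ifs with hi
      · simp only [false_iff]
        rintro rfl
        exact b.2 hi
      · simp [Subtype.ext_iff]
    have hπsurj : ∀ o, ∃ i, π i = o := by
      rintro (_ | b)
      · exact ⟨j0, (hπn _).2 (hAS _ hj0)⟩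
      · exact ⟨b.1, (hπs _ _).2 rfl⟩
    let F : Option {i // f i ∉ S} → ℂ[X] := fun o => ∑ i with π i = o, f i
    have hFs : ∀ b, F (some b) = f b.1 := by
      intro b
      have : (Finset.univ.filter (fun i => π i = some b)) = {b.1} := by
        ext i; simp [hπs]
      simp only [F]
      rw [this, Finset.sum_singleton]
    have hFn : F none ∈ S := by
      apply Submodule.sum_mem
      intro i hi
      exact (hπn i).1 (Finset.mem_filter.1 hi).2
    have hFT : ∀ T : Finset (Option {i // f i ∉ S}), ∑ o ∈ T, F o = ∑ i with π i ∈ T, f i :=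
      fun T => Finset.sum_fiberwise_eq_sum_filter _ _ _ _
    have hFsum : ∑ o, F o = 0 := by rw [hFT]; simpa using hsum
    have hFsub : ∀ T : Finset (Option {i // f i ∉ S}), T.Nonempty → T ≠ Finset.univ →
        ∑ o ∈ T, F o ≠ 0 := by
      intro T hT hT'
      rw [hFT]
      apply hsub
      · obtain ⟨o, ho⟩ := hT
        obtain ⟨i, hi⟩ := hπsurj o
        exact ⟨i, by simp [hi, ho]⟩
      · intro hu
        apply hT'
        ext o
        obtain ⟨i, rfl⟩ := hπsurj o
        have : i ∈ Finset.univ.filter (fun i => π i ∈ T) := by rw [hu]; exact Finset.mem_univ i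
        simpa using this
    have hF0 : ∀ o, F o ≠ 0 := by
      rintro (_ | b)
      · have := hFsub {none} (by simp) (by
          intro hu
          have : some ⟨b0, hb0⟩ ∈ ({none} : Finset (Option {i // f i ∉ S})) := by
            rw [hu]; exact Finset.mem_univ _
          simp at this)
        simpa using this
      · rw [hFs]; exact hne _
    obtain ⟨γ, k, hγ, hFk, hkco⟩ := exists_gcd_extract F none (hF0 none)
    have hk0 : ∀ o, k o ≠ 0 := fun o h0 => hF0 o (by rw [hFk, h0, mul_zero])
    have hkF := finrank_span_mul γ hγ F k hFk
    have hFle : Submodule.span ℂ (Set.range F) ≤ Submodule.span ℂ (Set.range f) := by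
      rw [Submodule.span_le]
      rintro _ ⟨o, rfl⟩
      exact Submodule.sum_mem _ (fun i _ => Submodule.subset_span ⟨i, rfl⟩)
    have hFd := Submodule.finrank_mono hFle
    have hFrank : 2 ≤ Module.finrank ℂ (Submodule.span ℂ (Set.range F)) := by
      have hp : LinearIndependent ℂ ![F none, F (some ⟨b0, hb0⟩)] := by
        rw [LinearIndependent.pair_iff]
        intro s t hst
        have ht : t = 0 := by
          by_contra ht
          apply hb0
          have h1 : f b0 = t⁻¹ • (- (s • F none)) := by
            rw [hFs] at hst
            rw [← eq_neg_of_add_eq_zero_right hst, smul_smul, inv_mul_cancel₀ ht, one_smul]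
          rw [h1]
          exact Submodule.smul_mem _ _ (Submodule.neg_mem _ (Submodule.smul_mem _ _ hFn))
        subst ht
        rw [zero_smul, add_zero] at hst
        exact ⟨(smul_eq_zero.1 hst).resolve_right (hF0 none), rfl⟩
      have h1 := finrank_span_eq_card hp
      have hFfin : FiniteDimensional ℂ (Submodule.span ℂ (Set.range F)) :=
        FiniteDimensional.span_of_finite ℂ (Set.finite_range F)
      have h2 : Submodule.span ℂ (Set.range ![F none, F (some ⟨b0, hb0⟩)])
          ≤ Submodule.span ℂ (Set.range F) := by
        apply Submodule.span_mono
        rintro _ ⟨i, rfl⟩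
        fin_cases i
        · exact ⟨none, rfl⟩
        · exact ⟨some ⟨b0, hb0⟩, rfl⟩
      have h3 := Submodule.finrank_mono h2
      rw [h1] at h3
      simpa using h3
    have hAB : ∀ i ∈ A, i ∉ Finset.univ.filter (fun i => f i ∉ S) := by
      intro i hi
      simp [hAS i hi]
    have hdisj : Disjoint A (Finset.univ.filter (fun i => f i ∉ S)) :=
      Finset.disjoint_left.2 (fun i hi => hAB i hi)
    have hcard' : Fintype.card (Option {i // f i ∉ S}) ≤ n := by
      rw [Fintype.card_option, Fintype.card_subtype]
      have h1 := Finset.card_union_of_disjoint hdisj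
      have h2 := Finset.card_le_univ (A ∪ Finset.univ.filter (fun i => f i ∉ S))
      omega
    obtain ⟨ρ, hρ2, hρd, hρ⟩ := ih (Option {i // f i ∉ S}) k hcard' hk0 (by omega) hkco
      (by
        apply mul_left_cancel₀ hγ
        rw [mul_zero, Finset.mul_sum, ← hFsum]
        exact Finset.sum_congr rfl (fun o _ => (hFk o).symm))
      (by
        intro T hT hT' h0
        apply hFsub T hT hT'
        have : ∑ o ∈ T, F o = γ * ∑ o ∈ T, k o := by
          rw [Finset.mul_sum]
          exact Finset.sum_congr rfl (fun o _ => hFk o)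
        rw [this, h0, mul_zero])
    have hmax : max r ρ = r ∨ max r ρ = ρ := by omega
    have hrm : r ≤ max r ρ := le_max_left _ _
    have hρm : ρ ≤ max r ρ := le_max_right _ _
    refine ⟨max r ρ, by omega, by omega, ?_⟩
    have htri : max r ρ * (max r ρ - 1) / 2 ≤ r * (r - 1) / 2 + ρ * (ρ - 1) / 2 := by
      rcases hmax with h | h <;> rw [h] <;> omega
    generalize max r ρ = R at *
    obtain ⟨k', hk'⟩ := (hSp _ hFn).1
    have hk'0 : k' ≠ 0 := by
      rintro rfl
      exact hF0 none (by rw [hk', mul_zero])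
    have hthree := local_three (R - 1) g γ (k none) k' hg hγ (hk0 none) hk'0
      (by rw [← hFk, hk']) (by
        intro a
        obtain ⟨i, hi⟩ := hco a
        by_cases hiS : f i ∈ S
        · left
          obtain ⟨q, hq⟩ := (hSp _ hiS).1
          intro h0
          apply hi
          rw [hq, eval_mul, h0, zero_mul]
        · right
          intro h0
          apply hi
          have h1 := hFs ⟨i, hiS⟩
          simp only [] at h1
          rw [← h1, hFk, eval_mul, h0, zero_mul])
    have hfour := local_four (R - 1) g (fun i : A => f i) h hg (fun i => hne i) hfh hhco
    have hhsum : ∑ i, rE (r - 1) (h i) ≤ ∑ i, rE (R - 1) (h i) :=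
      Finset.sum_le_sum (fun i _ => rE_mono_dvd _ _ (by omega) _ _ (hh i) dvd_rfl)
    have hksum : ∑ o, rE (ρ - 1) (k o) ≤ rE (R - 1) (k none)
        + ∑ b : {i // f i ∉ S}, rE (R - 1) (f b) := by
      rw [Fintype.sum_option]
      apply Nat.add_le_add
      · exact rE_mono_dvd _ _ (by omega) _ _ (hk0 _) dvd_rfl
      · apply Finset.sum_le_sum
        intro b _
        exact rE_mono_dvd _ _ (by omega) _ _ (hne _) ⟨γ, by rw [← hFs, hFk, mul_comm]⟩
    have htotal : ∑ i : A, rE (R - 1) (f i) + ∑ b : {i // f i ∉ S}, rE (R - 1) (f b)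
        ≤ ∑ i, rE (R - 1) (f i) := by
      rw [Finset.sum_coe_sort A (fun i => rE (R - 1) (f i)),
        ← Finset.sum_subtype (Finset.univ.filter (fun i => f i ∉ S)) (by simp)
          (fun i => rE (R - 1) (f i)), ← Finset.sum_union hdisj]
      exact Finset.sum_le_sum_of_subset (Finset.subset_univ _)
    have hHdeg := (hSp _ hFn).2
    rw [hFk, natDegree_mul hγ (hk0 none)] at hHdeg
    have hρ0 := hρ none
    intro m
    by_cases hmS : f m ∈ S
    · have h1 := (hSp _ hmS).2
      omega
    · have h1 := hρ (some ⟨m, hmS⟩)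
      have h2 : (f m).natDegree = γ.natDegree + (k (some ⟨m, hmS⟩)).natDegree := by
        rw [← natDegree_mul hγ (hk0 _), ← hFk, hFs]
      omega

theorem stmt6 (n : ℕ) (hn : 3 ≤ n) (f : Fin n → ℂ[X]) (hne : ∀ i, f i ≠ 0)
    (hconst : ¬ ∀ i, (f i).natDegree = 0)
    (hgcd : ∀ p : ℂ[X], (∀ i, p ∣ f i) → IsUnit p)
    (hsum : ∑ i, f i = 0)
    (hsub : ∀ S : Finset (Fin n), S.Nonempty → S ≠ Finset.univ → ∑ i ∈ S, f i ≠ 0)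
    (d : ℕ) (hd : d = Module.finrank ℂ (Submodule.span ℂ (Set.range f))) :
    ∃ ρ : ℕ, 2 ≤ ρ ∧ ρ ≤ d ∧
      ∀ m, ((f m).natDegree : ℤ) ≤
        (∑ i, (rE (ρ - 1) (f i) : ℤ)) - (ρ : ℤ) * ((ρ : ℤ) - 1) / 2 := by
  have hco : ∀ a, ∃ i, (f i).eval a ≠ 0 := by
    intro a
    by_contra! hcon
    exact not_isUnit_X_sub_C a (hgcd _ (fun i => dvd_iff_isRoot.2 (hcon i)))
  have hrank : 2 ≤ Module.finrank ℂ (Submodule.span ℂ (Set.range f)) := by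
    by_contra hlt
    have hfin : FiniteDimensional ℂ (Submodule.span ℂ (Set.range f)) :=
      FiniteDimensional.span_of_finite ℂ (Set.finite_range f)
    obtain ⟨v, hv⟩ := (Submodule.finrank_le_one_iff_isPrincipal
      (Submodule.span ℂ (Set.range f))).1 (by omega)
    have hdv : ∀ i, ∃ t : ℂ, f i = C t * v := by
      intro i
      have : f i ∈ Submodule.span ℂ (Set.range f) := Submodule.subset_span ⟨i, rfl⟩
      rw [hv] at this
      obtain ⟨t, ht⟩ := Submodule.mem_span_singleton.1 this
      exact ⟨t, by rw [← ht, smul_eq_C_mul]⟩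
    have hu := hgcd v (fun i => by
      obtain ⟨t, ht⟩ := hdv i
      exact ⟨C t, by rw [ht, mul_comm]⟩)
    apply hconst
    intro i
    obtain ⟨t, ht⟩ := hdv i
    have h1 := natDegree_eq_zero_of_isUnit hu
    have h2 := natDegree_C_mul_le t v
    rw [ht]
    omega
  obtain ⟨ρ, h2, hρd, hρ⟩ := main_ind n (Fin n) f (by simp) hne hrank hco hsum hsub
  refine ⟨ρ, h2, by omega, ?_⟩
  intro m
  have h1 := hρ m
  have h3 : (ρ : ℤ) * ((ρ : ℤ) - 1) / 2 = ((ρ * (ρ - 1) / 2 : ℕ) : ℤ) := by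
    push_cast [Nat.cast_sub (show 1 ≤ ρ by omega)]
    rfl
  rw [h3, ← Nat.cast_sum]
  omega
end

section
/- Let d be the dimension of the ℂ-span of f₁ = g₁^{e₁}, …, fₙ = gₙ^{eₙ}, where the fᵢ satisfy f₁ + ⋯ + fₙ = 0, are not all constant, and every vanishing subsum has gcd 1. Then ∑ᵢ 1/eᵢ > 1/(d−1). -/
open Polynomial

theorem ear_exists {K V ι : Type*} [Field K] [AddCommGroup V] [Module K V] [Fintype ι]
    [DecidableEq ι] (f : ι → V) (hsum : ∑ i, f i = 0)
    (hns : ∀ S : Finset ι, S.Nonempty → S ≠ Finset.univ → ∑ i ∈ S, f i ≠ 0)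
    (S : Finset ι) (hS : S.Nonempty) (hSu : S ≠ Finset.univ) :
    ∃ (A : Finset ι) (c : ι → K), A.Nonempty ∧ Disjoint S A ∧ (∀ i ∈ A, c i ≠ 0) ∧
      (∑ i ∈ A, c i • f i) ≠ 0 ∧ (∑ i ∈ A, c i • f i) ∈ Submodule.span K (f '' (S : Set ι)) ∧
      ∀ u ∈ A, ∀ c' : ι → K,
        (∑ i ∈ A.erase u, c' i • f i) ∈ Submodule.span K (f '' (S : Set ι)) →
        ∀ i ∈ A.erase u, c' i = 0 := by
  classical
  let P : Finset ι → Prop := fun A => Disjoint S A ∧ ∃ c : ι → K, 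
    (∑ i ∈ A, c i • f i) ≠ 0 ∧ (∑ i ∈ A, c i • f i) ∈ Submodule.span K (f '' (S : Set ι))
  have hex : ∃ A, P A := by
    have h1 : ∑ i ∈ Sᶜ, f i = - ∑ i ∈ S, f i := by
      rw [eq_neg_iff_add_eq_zero, add_comm, Finset.sum_add_sum_compl, hsum]
    refine ⟨Sᶜ, disjoint_compl_right, fun _ => 1, ?_, ?_⟩
    · simp only [one_smul, h1]
      exact neg_ne_zero.2 (hns S hS hSu)
    · simp only [one_smul, h1]
      refine Submodule.neg_mem _ (Submodule.sum_mem _ fun i hi => Submodule.subset_span ⟨i, hi, rfl⟩)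
  obtain ⟨A, hA, hmin⟩ := Finset.exists_min_image (Finset.univ.filter P) Finset.card
    (by obtain ⟨A, hA⟩ := hex; exact ⟨A, by simpa using hA⟩)
  replace hA : P A := by simpa using hA
  replace hmin : ∀ A', P A' → A.card ≤ A'.card := fun A' h => hmin A' (by simpa using h)
  obtain ⟨hd, c, hc0, hcS⟩ := hA
  have herase : ∀ u ∈ A, ¬ P (A.erase u) := fun u hu h => by
    have := hmin _ h
    have := Finset.card_erase_lt_of_mem hu
    omega
  have hde : ∀ u, Disjoint S (A.erase u) := fun u => hd.mono_right (Finset.erase_subset _ _)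
  have hcne : ∀ i ∈ A, c i ≠ 0 := by
    intro i hi h0
    refine herase i hi ⟨hde i, c, ?_⟩
    have : ∑ j ∈ A.erase i, c j • f j = ∑ j ∈ A, c j • f j := by
      rw [← Finset.add_sum_erase A _ hi, h0]; simp
    rw [this]; exact ⟨hc0, hcS⟩
  refine ⟨A, c, ?_, hd, hcne, hc0, hcS, ?_⟩
  · by_contra h
    rw [Finset.not_nonempty_iff_eq_empty] at h
    simp [h] at hc0
  · intro u hu c' hc' i hi
    by_contra hci
    have hz : ∑ i ∈ A.erase u, c' i • f i = 0 := by
      by_contra hz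
      exact herase u hu ⟨hde u, c', hz, hc'⟩
    have hiA := Finset.mem_of_mem_erase hi
    let e : ι → K := fun j => if j = u then 0 else c' j
    have hez : ∑ j ∈ A, e j • f j = 0 := by
      rw [← Finset.add_sum_erase A _ hu, ← hz]
      simp only [e, if_true, zero_smul, zero_add]
      exact Finset.sum_congr rfl fun j hj => by rw [if_neg (Finset.ne_of_mem_erase hj)]
    have hei : e i ≠ 0 := by simp only [e, if_neg (Finset.ne_of_mem_erase hi)]; exact hci
    refine herase i hiA ⟨hde i, fun j => c j - (c i / e i) * e j, ?_⟩
    have : ∑ j ∈ A.erase i, (c j - (c i / e i) * e j) • f j = ∑ j ∈ A, c j • f j := by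
      have h2 : ∑ j ∈ A, (c j - (c i / e i) * e j) • f j = ∑ j ∈ A, c j • f j := by
        simp only [sub_smul, mul_smul, Finset.sum_sub_distrib, ← Finset.smul_sum, hez, smul_zero,
          sub_zero]
      rw [← h2, ← Finset.add_sum_erase A _ hiA, div_mul_cancel₀ _ hei]; simp
    rw [this]; exact ⟨hc0, hcS⟩

theorem key {K V ι P : Type*} [Field K] [AddCommGroup V] [Module K V] [Fintype ι]
    [DecidableEq ι] [Fintype P] (f : ι → V) (hsum : ∑ i, f i = 0)
    (hns : ∀ S : Finset ι, S.Nonempty → S ≠ Finset.univ → ∑ i ∈ S, f i ≠ 0)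
    (hf0 : ∀ i, f i ≠ 0)
    (w : P → V → ℤ)
    (hM : ∀ p t, ∃ M : Submodule K V, ∀ y ≠ 0, y ∈ M ↔ t ≤ w p y)
    (hle : ∀ y ≠ 0, ∑ p, w p y ≤ 0) (heq : ∀ i, ∑ p, w p (f i) = 0)
    (hne : (Finset.univ : Finset ι).Nonempty) :
    ∃ B : P → Finset ι, (∀ p, LinearIndepOn K f (B p : Set ι)) ∧
      (∀ p, Submodule.span K (f '' (B p : Set ι)) = Submodule.span K (Set.range f)) ∧
      0 ≤ ∑ p, ∑ i ∈ B p, w p (f i) + ∑ p, Finset.univ.inf' hne (fun i => w p (f i)) := by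
  classical
  let Q : Finset ι → Prop := fun S => ∃ hS : S.Nonempty, ∃ B : P → Finset ι, (∀ p, B p ⊆ S) ∧
      (∀ p, LinearIndepOn K f (B p : Set ι)) ∧
      (∀ p, Submodule.span K (f '' (B p : Set ι)) = Submodule.span K (f '' (S : Set ι))) ∧
      0 ≤ ∑ p, ∑ i ∈ B p, w p (f i) + ∑ p, S.inf' hS (fun i => w p (f i))
  have hult : ∀ p (S : Finset ι) (hS : S.Nonempty) y, y ≠ 0 →
      y ∈ Submodule.span K (f '' (S : Set ι)) → S.inf' hS (fun i => w p (f i)) ≤ w p y := by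
    intro p S hS y hy hyS
    obtain ⟨M, hM⟩ := hM p (S.inf' hS (fun i => w p (f i)))
    rw [← hM y hy]
    refine Submodule.span_le.2 ?_ hyS
    rintro _ ⟨i, hi, rfl⟩
    exact (hM _ (hf0 i)).2 (Finset.inf'_le (fun i => w p (f i)) hi)
  have step : ∀ S, Q S → S ≠ Finset.univ → ∃ S', Q S' ∧ S.card < S'.card := by
    rintro S ⟨hS, B, hBS, hBi, hBs, hB⟩ hSu
    obtain ⟨A, c, hAne, hSA, hc, hy0, hyS, hA⟩ := ear_exists (K := K) f hsum hns S hS hSu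
    set y := ∑ i ∈ A, c i • f i with hy
    choose u huA hu using fun p => Finset.exists_mem_eq_inf' hAne (fun i => w p (f i))
    have hdis : ∀ p, Disjoint (B p) (A.erase (u p)) := fun p =>
      (hSA.mono_left (hBS p)).mono_right (Finset.erase_subset _ _)
    refine ⟨S ∪ A, ⟨hS.mono Finset.subset_union_left, fun p => B p ∪ A.erase (u p), ?_, ?_, ?_, ?_⟩, ?_⟩
    · intro p
      exact Finset.union_subset_union (hBS p) (Finset.erase_subset _ _)
    · intro p
      rw [Finset.coe_union]
      refine (hBi p).union ?_ ?_
      · rw [linearIndepOn_finset_iff]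
        intro c' hc'
        exact hA _ (huA p) c' (by rw [hc']; exact Submodule.zero_mem _)
      · rw [hBs p, Submodule.disjoint_def]
        intro x hx hx'
        rw [Submodule.mem_span_image_finset_iff_exists_fun'] at hx'
        obtain ⟨c', rfl⟩ := hx'
        have := hA _ (huA p) c' hx
        exact Finset.sum_eq_zero fun i hi => by rw [this i hi, zero_smul]
    · intro p
      apply le_antisymm
      · exact Submodule.span_mono (Set.image_mono (by
          exact_mod_cast Finset.union_subset_union (hBS p) (Finset.erase_subset (u p) A)))
      · rw [Submodule.span_le]
        rintro _ ⟨i, hi, rfl⟩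
        have hS1 : Submodule.span K (f '' (S : Set ι)) ≤
            Submodule.span K (f '' ((B p ∪ A.erase (u p) : Finset ι) : Set ι)) := by
          rw [← hBs p]
          exact Submodule.span_mono (Set.image_mono (by simp))
        have hA1 : ∀ j ∈ A.erase (u p), f j ∈ 
            Submodule.span K (f '' ((B p ∪ A.erase (u p) : Finset ι) : Set ι)) := fun j hj =>
          Submodule.subset_span ⟨j, Finset.mem_coe.2 (Finset.mem_union_right _ hj), rfl⟩
        rcases Finset.mem_union.1 (Finset.mem_coe.1 hi) with hi | hi
        · exact hS1 (Submodule.subset_span ⟨i, hi, rfl⟩)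
        · by_cases hiu : i = u p
          · have h1 : c (u p) • f (u p) = y - ∑ j ∈ A.erase (u p), c j • f j := by
              rw [hy, ← Finset.add_sum_erase A _ (huA p)]; simp
            have h2 : c (u p) • f (u p) ∈
              Submodule.span K (f '' ((B p ∪ A.erase (u p) : Finset ι) : Set ι)) := by
              rw [h1]
              exact Submodule.sub_mem _ (hS1 hyS)
                (Submodule.sum_mem _ fun j hj => Submodule.smul_mem _ _ (hA1 j hj))
            rw [hiu]
            exact (Submodule.smul_mem_iff _ (hc _ (huA p))).1 h2
          · exact hA1 i (Finset.mem_erase.2 ⟨hiu, hi⟩)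
    · have h1 : ∀ p, ∑ i ∈ B p ∪ A.erase (u p), w p (f i) =
          ∑ i ∈ B p, w p (f i) + ∑ i ∈ A, w p (f i) - A.inf' hAne (fun i => w p (f i)) := by
        intro p
        rw [Finset.sum_union (hdis p), ← Finset.add_sum_erase A _ (huA p), hu p]; ring
      have h2 : ∑ p, ∑ i ∈ A, w p (f i) = 0 := by
        rw [Finset.sum_comm]; exact Finset.sum_eq_zero fun i _ => heq i
      have h3 : ∀ p, S.inf' hS (fun i => w p (f i)) - w p y + A.inf' hAne (fun i => w p (f i)) ≤ 
          (S ∪ A).inf' (hS.mono Finset.subset_union_left) (fun i => w p (f i)) := by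
        intro p
        rw [Finset.inf'_union hS hAne]
        have ha := hult p S hS y hy0 hyS
        have hb := hult p A hAne y hy0 
          (Submodule.sum_mem _ fun i hi => Submodule.smul_mem _ _ (Submodule.subset_span ⟨i, hi, rfl⟩))
        rw [le_inf_iff]
        constructor <;> linarith
      have h4 := Finset.sum_le_sum (s := Finset.univ) fun p _ => h3 p
      have h5 := hle y hy0
      simp only [h1, Finset.sum_add_distrib, Finset.sum_sub_distrib, h2] at h4 ⊢
      linarith
    · rw [Finset.card_union_of_disjoint hSA]
      have := hAne.card_pos
      omega
  have hQ0 : ∃ S, Q S := by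
    obtain ⟨m, -⟩ := hne
    refine ⟨{m}, by simp, fun _ => {m}, fun _ => subset_rfl, fun p => ?_, fun _ => rfl, ?_⟩
    · simpa using hf0 m
    · simp [heq]
  obtain ⟨S, hS, hmax⟩ := Finset.exists_max_image (Finset.univ.filter Q) Finset.card
    (by obtain ⟨A, hA⟩ := hQ0; exact ⟨A, by simpa using hA⟩)
  replace hS : Q S := by simpa using hS
  have hSu : S = Finset.univ := by
    by_contra h
    obtain ⟨S', hS', hlt⟩ := step S hS h
    have := hmax S' (by simpa using hS')
    omega
  subst hSu
  obtain ⟨_, B, _, h1, h2, h3⟩ := hS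
  exact ⟨B, h1, by simpa using h2, h3⟩

/-- Wronskian matrix. -/
noncomputable def wrMat {d : ℕ} (b : Fin d → ℂ[X]) : Matrix (Fin d) (Fin d) ℂ[X] :=
  Matrix.of fun i j => derivative^[(i : ℕ)] (b j)

theorem deg_eq_of_wr {p q : ℂ[X]} (hp : p ≠ 0) (hq : q ≠ 0)
    (h : p * derivative q = derivative p * q) : p.natDegree = q.natDegree := by
  by_contra hne
  have hpl := leadingCoeff_ne_zero.2 hp
  have hql := leadingCoeff_ne_zero.2 hq
  have key : ∀ p q : ℂ[X], (X * (p * derivative q)).coeff (p.natDegree + q.natDegree)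
      = q.natDegree * (p.leadingCoeff * q.leadingCoeff) := by
    intro p q
    rw [show X * (p * derivative q) = p * (X * derivative q) by ring, coeff_mul_add_eq_of_natDegree_le le_rfl]
    · rcases Nat.eq_zero_or_pos q.natDegree with h | h
      · rw [h]; simp
      · obtain ⟨k, hk⟩ := Nat.exists_eq_succ_of_ne_zero h.ne'
        rw [leadingCoeff, leadingCoeff, hk, Nat.succ_eq_add_one, coeff_X_mul, coeff_derivative]
        push_cast; ring
    · by_cases hz : derivative q = 0
      · simp [hz]
      · have hq : q.natDegree ≠ 0 := fun h => hz (derivative_of_natDegree_zero h)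
        have := natDegree_derivative_lt hq
        have := natDegree_mul_le (p := X) (q := derivative q)
        simp at this
        omega
  have h1 := key p q
  have h2 := key q p
  rw [h, show X * (derivative p * q) = X * (q * derivative p) by ring, add_comm, h2] at h1
  rw [mul_comm q.leadingCoeff] at h1
  have := mul_right_cancel₀ (mul_ne_zero hpl hql) h1
  exact hne (by exact_mod_cast this)

theorem prop_of_wr {p q : ℂ[X]} (hp : p ≠ 0)
    (h : p * derivative q = derivative p * q) : ∃ l : ℂ, q = C l * p := by
  by_cases hq : q = 0
  · exact ⟨0, by simp [hq]⟩
  have hpl := leadingCoeff_ne_zero.2 hp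
  have hdeg := deg_eq_of_wr hp hq h
  refine ⟨q.leadingCoeff / p.leadingCoeff, ?_⟩
  by_contra hne
  have hr : q - C (q.leadingCoeff / p.leadingCoeff) * p ≠ 0 := sub_ne_zero.2 hne
  have h2 := deg_eq_of_wr hp hr (by
    simp only [derivative_sub, derivative_C_mul, mul_sub, h]; ring)
  have hql := leadingCoeff_ne_zero.2 hq
  have hl : q.leadingCoeff / p.leadingCoeff ≠ 0 := div_ne_zero hql hpl
  have h3 : (q - C (q.leadingCoeff / p.leadingCoeff) * p).degree < q.degree := by
    apply degree_sub_lt_left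
    · rw [degree_C_mul hl, degree_eq_natDegree hp, degree_eq_natDegree hq, hdeg]
    · exact hq
    · rw [leadingCoeff_mul, leadingCoeff_C, div_mul_cancel₀ _ hpl]
  have := natDegree_lt_natDegree hr h3
  omega

theorem wr_ne_zero_s10 : ∀ {d : ℕ} (b : Fin d → ℂ[X]), LinearIndependent ℂ b → (wrMat b).det ≠ 0 := by
  intro d
  induction d with
  | zero => intro b _; simp
  | succ d ih =>
    intro b hb hdet
    have htail : (wrMat (Fin.tail b)).det ≠ 0 := ih _ (linearIndependent_finSucc.1 hb).1
    obtain ⟨c, hc, hmul⟩ := Matrix.exists_mulVec_eq_zero_iff.2 hdet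
    have hrow : ∀ i : ℕ, i < d + 1 → ∑ j, derivative^[i] (b j) * c j = 0 := by
      intro i hi
      have := congrFun hmul ⟨i, hi⟩
      simpa [Matrix.mulVec, dotProduct, wrMat] using this
    have hrow' : ∀ i : ℕ, i < d → ∑ j, derivative^[i] (b j) * derivative (c j) = 0 := by
      intro i hi
      have h1 := congrArg derivative (hrow i (by omega))
      simp only [derivative_sum, derivative_mul, derivative_zero, Finset.sum_add_distrib,
        ← Function.iterate_succ_apply' (⇑derivative)] at h1
      rw [hrow (i+1) (by omega), zero_add] at h1
      exact h1
    have hzero : ∀ e : Fin d → ℂ[X], (∀ i : ℕ, i < d →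
        ∑ j : Fin d, derivative^[i] (b j.succ) * e j = 0) → e = 0 := by
      intro e he
      by_contra hne
      refine htail (Matrix.exists_mulVec_eq_zero_iff.1 ⟨e, hne, ?_⟩)
      ext1 i
      simpa [Matrix.mulVec, dotProduct, wrMat, Fin.tail] using he i i.2
    have hc0 : c 0 ≠ 0 := by
      intro h0
      apply hc
      have := hzero (fun j => c j.succ) (fun i hi => by
        have := hrow i (by omega)
        rwa [Fin.sum_univ_succ, h0, mul_zero, zero_add] at this)
      ext1 j
      refine Fin.cases h0 (fun j => congrFun this j) j
    have hw := hzero (fun j => c 0 * derivative (c j.succ) - derivative (c 0) * c j.succ) (by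
      intro i hi
      have h1 := hrow i (by omega)
      have h2 := hrow' i hi
      rw [Fin.sum_univ_succ] at h1 h2
      have : ∑ j : Fin d, derivative^[i] (b j.succ) *
          (c 0 * derivative (c j.succ) - derivative (c 0) * c j.succ)
          = c 0 * ∑ j : Fin d, derivative^[i] (b j.succ) * derivative (c j.succ)
          - derivative (c 0) * ∑ j : Fin d, derivative^[i] (b j.succ) * c j.succ := by
        rw [Finset.mul_sum, Finset.mul_sum, ← Finset.sum_sub_distrib]
        exact Finset.sum_congr rfl fun j _ => by ring
      rw [this]
      linear_combination c 0 * h2 - derivative (c 0) * h1)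
    have hl : ∀ j, ∃ l : ℂ, c j = C l * c 0 := by
      intro j
      refine Fin.cases ⟨1, by simp⟩ (fun j => ?_) j
      exact prop_of_wr hc0 (sub_eq_zero.1 (congrFun hw j))
    choose l hl using hl
    have h0 := hrow 0 (by omega)
    have h1 : (∑ j, l j • b j) * c 0 = 0 := by
      rw [← h0, Finset.sum_mul]
      refine Finset.sum_congr rfl fun j _ => ?_
      rw [Function.iterate_zero_apply, hl j, smul_eq_C_mul, Polynomial.C_mul']
      simp only [← smul_eq_C_mul]
      simp
    have h2 := (mul_eq_zero.1 h1).resolve_right hc0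
    have h3 := Fintype.linearIndependent_iff.1 hb l h2 0
    have h4 := hl 0
    rw [h3] at h4
    simp at h4
    exact hc0 h4

theorem wr_dvd_s10 {d : ℕ} (b b' : Fin d → ℂ[X])
    (h : ∀ j, b j ∈ Submodule.span ℂ (Set.range b')) : ∃ z : ℂ, (wrMat b).det = (wrMat b').det * C z := by
  choose c hc using fun j => (Submodule.mem_span_range_iff_exists_fun ℂ).1 (h j)
  let M : Matrix (Fin d) (Fin d) ℂ := Matrix.of fun k j => c j k
  refine ⟨M.det, ?_⟩
  have : wrMat b = wrMat b' * M.map C := by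
    ext1 i j
    simp only [wrMat, Matrix.mul_apply, Matrix.of_apply, Matrix.map_apply, M]
    rw [← hc j, iterate_derivative_sum]
    refine Finset.sum_congr rfl fun k _ => ?_
    rw [iterate_derivative_smul, smul_eq_C_mul, mul_comm]
  rw [this, Matrix.det_mul, ← RingHom.mapMatrix_apply, ← RingHom.map_det]

theorem wr_deg {d : ℕ} (b : Fin d → ℂ[X]) (h : (wrMat b).det ≠ 0) :
    (wrMat b).det.natDegree + (d - 1) ≤ ∑ j, (b j).natDegree := by
  rcases d with _ | d
  · simp
  have key : ∀ σ : Equiv.Perm (Fin (d+1)), ∏ i, wrMat b (σ i) i = 0 ∨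
      (∏ i, wrMat b (σ i) i).natDegree + d ≤ ∑ j, (b j).natDegree := by
    intro σ
    by_cases h0 : ∏ i, wrMat b (σ i) i = 0
    · exact Or.inl h0
    right
    rw [Finset.prod_eq_zero_iff] at h0
    push Not at h0
    rw [natDegree_prod _ _ h0]
    have hle : ∀ j, (wrMat b (σ j) j).natDegree + (σ j : ℕ) ≤ (b j).natDegree := by
      intro j
      have h1 := h0 j (Finset.mem_univ _)
      simp only [wrMat, Matrix.of_apply] at h1 ⊢
      have h2 := natDegree_iterate_derivative (b j) (σ j)
      have h3 : (σ j : ℕ) ≤ (b j).natDegree := by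
        by_contra hlt
        exact h1 (iterate_derivative_eq_zero (not_le.1 hlt))
      omega
    have h4 := Finset.sum_le_sum (s := Finset.univ) fun j _ => hle j
    rw [Finset.sum_add_distrib] at h4
    have h5 : d ≤ ∑ j, (σ j : ℕ) := by
      have := Finset.single_le_sum (f := fun j => (σ j : ℕ)) (fun _ _ => Nat.zero_le _)
        (Finset.mem_univ (σ.symm (Fin.last d)))
      simpa using this
    omega
  have hex : ∃ σ : Equiv.Perm (Fin (d+1)), ∏ i, wrMat b (σ i) i ≠ 0 := by
    by_contra hall
    push Not at hall
    apply h
    rw [Matrix.det_apply]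
    simp [hall]
  obtain ⟨σ0, hσ0⟩ := hex
  have hd := (key σ0).resolve_left hσ0
  have : (wrMat b).det.natDegree ≤ ∑ j, (b j).natDegree - d := by
    rw [Matrix.det_apply]
    refine natDegree_sum_le_of_forall_le _ _ fun σ _ => ?_
    refine (natDegree_smul_le _ _).trans ?_
    rcases key σ with h | h
    · simp [h]
    · omega
  simp only [Nat.add_sub_cancel]
  omega

theorem wr_local_s10 {d : ℕ} (b : Fin d → ℂ[X]) (a : ℂ) :
    (X - C a) ^ (∑ j, ((b j).rootMultiplicity a - (d - 1))) ∣ (wrMat b).det := by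
  rw [Matrix.det_apply]
  refine Finset.dvd_sum fun σ _ => ?_
  rw [Units.smul_def, zsmul_eq_mul]
  refine Dvd.dvd.mul_left ?_ _
  rw [← Finset.prod_pow_eq_pow_sum]
  refine Finset.prod_dvd_prod_of_dvd _ _ fun j _ => ?_
  refine (pow_dvd_pow _ ?_).trans (pow_sub_dvd_iterate_derivative_of_pow_dvd (σ j : ℕ)
    (pow_rootMultiplicity_dvd (b j) a))
  have := (σ j).2
  omega

theorem sum_le_natDegree (R : Finset ℂ) (T : ℂ → ℕ) (y : ℂ[X]) (hy : y ≠ 0)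
    (h : ∀ a ∈ R, (X - C a) ^ T a ∣ y) : ∑ a ∈ R, T a ≤ y.natDegree := by
  have h1 : ∏ a ∈ R, (X - C a) ^ T a ∣ y := by
    refine Finset.prod_dvd_of_coprime ?_ h
    intro a _ b _ hab
    exact (pairwise_coprime_X_sub_C (s := fun x : ℂ => x) Function.injective_id hab).pow
  have h2 := natDegree_le_of_dvd h1 hy
  rw [natDegree_prod _ _ (fun a _ => pow_ne_zero _ (X_sub_C_ne_zero a))] at h2
  simpa using h2

theorem sum_eq_natDegree (R : Finset ℂ) (y : ℂ[X]) 
    (h : ∀ a ∈ y.roots, a ∈ R) : ∑ a ∈ R, y.rootMultiplicity a = y.natDegree := by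
  rw [splits_iff_card_roots.1 (IsAlgClosed.splits y) |>.symm, ← Multiset.sum_count_eq_card h]
  simp

theorem core {ι : Type*} [Fintype ι] [DecidableEq ι] (f g : ι → ℂ[X]) (e : ι → ℕ)
    (hf : ∀ i, f i = g i ^ e i) (hg : ∀ i, g i ≠ 0) (hsum : ∑ i, f i = 0)
    (hns : ∀ S : Finset ι, S.Nonempty → S ≠ Finset.univ → ∑ i ∈ S, f i ≠ 0)
    (hgcd : ∀ p : ℂ[X], (∀ i, p ∣ f i) → IsUnit p)
    (D : ℕ) (m : ι) (hD : ∀ i, (f i).natDegree ≤ D) (d : ℕ)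
    (hm : (f m).natDegree = D)
    (hd : d = Module.finrank ℂ (Submodule.span ℂ (Set.range f))) :
    D + (d - 1) ≤ (d - 1) * ∑ i, (g i).natDegree := by
  have hf0 : ∀ i, f i ≠ 0 := fun i => by rw [hf]; exact pow_ne_zero _ (hg i)
  have hp0 : ∏ i, f i ≠ 0 := Finset.prod_ne_zero_iff.2 fun i _ => hf0 i
  let R : Finset ℂ := (∏ i, f i).roots.toFinset
  have hR : ∀ i, ∀ a ∈ (f i).roots, a ∈ R := by
    intro i a ha
    rw [Multiset.mem_toFinset]
    exact Multiset.mem_of_le (roots.le_of_dvd hp0 (Finset.dvd_prod_of_mem f (Finset.mem_univ i))) ha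
  let w : Option R → ℂ[X] → ℤ := fun p y =>
    match p with
    | none => -(y.natDegree : ℤ)
    | some a => (y.rootMultiplicity (a : ℂ) : ℤ)
  have hsw : ∀ y, ∑ p, w p y = -(y.natDegree : ℤ) + ((∑ a ∈ R, y.rootMultiplicity a : ℕ) : ℤ) := by
    intro y
    rw [Fintype.sum_option, ← Finset.sum_coe_sort R]
    simp [w]
  have hne : (Finset.univ : Finset ι).Nonempty := ⟨m, Finset.mem_univ m⟩
  have hw1 : ∀ p t, ∃ M : Submodule ℂ ℂ[X], ∀ y ≠ 0, y ∈ M ↔ t ≤ w p y := by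
    rintro (_ | a) t
    · refine ⟨degreeLT ℂ (-t + 1).toNat, fun y hy => ?_⟩
      rw [mem_degreeLT, degree_eq_natDegree hy, Nat.cast_lt]
      simp only [w]
      omega
    · refine ⟨(Ideal.span {(X - C (a : ℂ)) ^ t.toNat}).restrictScalars ℂ, fun y hy => ?_⟩
      rw [Submodule.restrictScalars_mem, Ideal.mem_span_singleton, ← le_rootMultiplicity_iff hy]
      simp only [w]
      omega
  have hw2 : ∀ y ≠ 0, ∑ p, w p y ≤ 0 := by
    intro y hy
    rw [hsw]
    have := sum_le_natDegree R (fun a => y.rootMultiplicity a) y hy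
      (fun a _ => pow_rootMultiplicity_dvd y a)
    omega
  have hw3 : ∀ i, ∑ p, w p (f i) = 0 := by
    intro i
    rw [hsw, sum_eq_natDegree R _ (hR i)]
    simp
  obtain ⟨B, hBi, hBs, hB⟩ := key (K := ℂ) f hsum hns hf0 w hw1 hw2 hw3 hne
  -- bases
  have hcard : ∀ p, (B p).card = d := by
    intro p
    have := finrank_span_eq_card (hBi p)
    rw [hd, ← hBs p, ← Set.image_eq_range] at *
    rw [this]; simp
  let b : Option R → Fin d → ι := fun p j => ((B p).equivFinOfCardEq (hcard p)).symm j
  have hb_sum : ∀ p (F : ι → ℕ), ∑ j, F (b p j) = ∑ i ∈ B p, F i := by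
    intro p F
    rw [← Finset.sum_coe_sort (B p)]
    exact Equiv.sum_comp ((B p).equivFinOfCardEq (hcard p)).symm (fun i : B p => F i)
  have hb_range : ∀ p, Set.range (fun j => f (b p j)) = f '' (B p : Set ι) := by
    intro p
    ext y
    constructor
    · rintro ⟨j, rfl⟩
      exact ⟨_, (((B p).equivFinOfCardEq (hcard p)).symm j).2, rfl⟩
    · rintro ⟨i, hi, rfl⟩
      exact ⟨(B p).equivFinOfCardEq (hcard p) ⟨i, hi⟩, by simp [b]⟩
  have hb_ind : ∀ p, LinearIndependent ℂ (fun j => f (b p j)) := by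
    intro p
    exact (hBi p).comp _ ((B p).equivFinOfCardEq (hcard p)).symm.injective
  set W := (wrMat (fun j => f (b none j))).det with hW
  have hW0 : W ≠ 0 := wr_ne_zero_s10 _ (hb_ind none)
  have hWdeg := wr_deg _ hW0
  rw [← hW, hb_sum none (fun i => (f i).natDegree)] at hWdeg
  let T : R → ℕ := fun a => ∑ i ∈ B (some a), ((f i).rootMultiplicity (a : ℂ) - (d - 1))
  have hT : ∀ a : R, (X - C (a : ℂ)) ^ T a ∣ W := by
    intro a
    obtain ⟨z, hz⟩ := wr_dvd_s10 (fun j => f (b none j)) (fun j => f (b (some a) j)) (by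
      intro j
      rw [hb_range, hBs]
      exact Submodule.subset_span ⟨_, rfl⟩)
    rw [hW, hz]
    refine Dvd.dvd.mul_right ?_ _
    have := wr_local_s10 (fun j => f (b (some a) j)) (a : ℂ)
    rwa [hb_sum (some a) (fun i => (f i).rootMultiplicity (a : ℂ) - (d - 1))] at this
  have hTW : ∑ a : R, T a ≤ W.natDegree := by
    have := sum_le_natDegree R (fun a => if h : a ∈ R then T ⟨a, h⟩ else 0) W hW0 (by
      intro a ha
      simpa only [dif_pos ha] using hT ⟨a, ha⟩)
    rw [← Finset.sum_coe_sort R] at this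
    simpa using this
  have hrad : ∑ a : R, ∑ i ∈ B (some a), (if (f i).rootMultiplicity (a : ℂ) = 0 then 0 else 1)
      ≤ ∑ i, (g i).natDegree := by
    calc _ ≤ ∑ a : R, ∑ i, (if (f i).rootMultiplicity (a : ℂ) = 0 then 0 else 1) :=
          Finset.sum_le_sum fun a _ => Finset.sum_le_sum_of_subset (Finset.subset_univ _)
      _ = ∑ i, ∑ a : R, (if (f i).rootMultiplicity (a : ℂ) = 0 then 0 else 1) := Finset.sum_comm
      _ ≤ ∑ i, (g i).natDegree := by
          refine Finset.sum_le_sum fun i _ => ?_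
          rw [Finset.sum_coe_sort R (fun a => if (f i).rootMultiplicity (a : ℂ) = 0 then 0 else 1)]
          refine sum_le_natDegree R _ (g i) (hg i) fun a _ => ?_
          split_ifs with h
          · simp
          · rw [pow_one, dvd_iff_isRoot]
            have h1 : (f i).IsRoot a := by
              by_contra h2; exact h (rootMultiplicity_eq_zero h2)
            rw [hf i, IsRoot, eval_pow] at h1
            exact by_contra fun h3 => pow_ne_zero _ h3 h1
  have hloc : ∑ a : R, ∑ i ∈ B (some a), (f i).rootMultiplicity (a : ℂ) ≤
      ∑ a : R, T a + (d - 1) * 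
        ∑ a : R, ∑ i ∈ B (some a), (if (f i).rootMultiplicity (a : ℂ) = 0 then 0 else 1) := by
    rw [Finset.mul_sum, ← Finset.sum_add_distrib]
    refine Finset.sum_le_sum fun a _ => ?_
    rw [Finset.mul_sum, ← Finset.sum_add_distrib]
    refine Finset.sum_le_sum fun i _ => ?_
    split_ifs with h <;> omega
  have hinf0 : Finset.univ.inf' hne (fun i => w none (f i)) ≤ -(D : ℤ) := by
    refine (Finset.inf'_le _ (Finset.mem_univ m)).trans ?_
    simp [w, hm]
  have hinfa : ∀ a : R, Finset.univ.inf' hne (fun i => w (some a) (f i)) ≤ 0 := by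
    intro a
    have : ∃ i, (f i).rootMultiplicity (a : ℂ) = 0 := by
      by_contra hall
      push Not at hall
      refine not_isUnit_X_sub_C (a : ℂ) (hgcd _ fun i => ?_)
      rw [dvd_iff_isRoot]
      by_contra h2; exact hall i (rootMultiplicity_eq_zero h2)
    obtain ⟨i, hi⟩ := this
    refine (Finset.inf'_le _ (Finset.mem_univ i)).trans ?_
    simp [w, hi]
  rw [Fintype.sum_option, Fintype.sum_option] at hB
  have hinfs : ∑ a : R, Finset.univ.inf' hne (fun i => w (some a) (f i)) ≤ 0 :=
    Finset.sum_nonpos fun a _ => hinfa a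
  have e1 : ∑ i ∈ B none, w none (f i) = -((∑ i ∈ B none, (f i).natDegree : ℕ) : ℤ) := by
    simp [w]
  have e2 : ∑ a : R, ∑ i ∈ B (some a), w (some a) (f i) =
      ((∑ a : R, ∑ i ∈ B (some a), (f i).rootMultiplicity (a : ℂ) : ℕ) : ℤ) := by
    simp [w]
  rw [e1, e2] at hB
  have hmul := Nat.mul_le_mul_left (d - 1) hrad
  omega

theorem stmt10 (n : ℕ) (g : Fin n → ℂ[X]) (e : Fin n → ℕ) (f : Fin n → ℂ[X])
    (hf : ∀ i, f i = g i ^ e i)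
    (hne : ∀ i, g i ≠ 0) (he : ∀ i, 0 < e i)
    (hconst : ¬ ∀ i, (f i).natDegree = 0)
    (hsum : ∑ i, f i = 0)
    (hgcd : ∀ S : Finset (Fin n), S.Nonempty → (∑ i ∈ S, f i) = 0 →
      ∀ p : ℂ[X], (∀ i ∈ S, p ∣ f i) → IsUnit p)
    (d : ℕ) (hd : d = Module.finrank ℂ (Submodule.span ℂ (Set.range f))) :
    (1 : ℚ) / ((d : ℚ) - 1) < ∑ i, (1 : ℚ) / (e i : ℚ) := by
  classical
  -- minimal nonconstant vanishing subsum
  let P : Finset (Fin n) → Prop := fun S => ∑ i ∈ S, f i = 0 ∧ ∃ i ∈ S, (f i).natDegree ≠ 0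
  have hPu : P Finset.univ := ⟨hsum, by push Not at hconst; simpa using hconst⟩
  obtain ⟨S, hS, hmin⟩ := Finset.exists_min_image (Finset.univ.filter P) Finset.card
    ⟨Finset.univ, by simpa using hPu⟩
  replace hS : P S := by simpa using hS
  replace hmin : ∀ A', P A' → S.card ≤ A'.card := fun A' h => hmin A' (by simpa using h)
  obtain ⟨hS0, i0, hi0, hi0d⟩ := hS
  have hns : ∀ T ⊆ S, T.Nonempty → T ≠ S → ∑ i ∈ T, f i ≠ 0 := by
    intro T hTS hT hne h0
    have hlt : T.card < S.card := Finset.card_lt_card (hTS.ssubset_of_ne hne)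
    by_cases hi : i0 ∈ T
    · have := hmin T ⟨h0, i0, hi, hi0d⟩
      omega
    · have h1 : ∑ i ∈ S \ T, f i = 0 := by
        have := Finset.sum_sdiff (f := f) hTS
        rw [h0, hS0, add_zero] at this
        exact this
      have := hmin (S \ T) ⟨h1, i0, by simp [hi0, hi], hi0d⟩
      rw [Finset.card_sdiff_of_subset hTS] at this
      have := hT.card_pos
      omega
  obtain ⟨m, hmS, hm⟩ := Finset.exists_max_image S (fun i => (f i).natDegree) ⟨i0, hi0⟩
  set D := (f m).natDegree with hDdef
  have hDpos : 0 < D := lt_of_lt_of_le (Nat.pos_of_ne_zero hi0d) (hm i0 hi0)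
  have hcore := core (ι := S) (fun i => f i) (fun i => g i) (fun i => e i) (fun i => hf i)
    (fun i => hne i) (by rw [Finset.sum_coe_sort S f]; exact hS0)
    (by
      intro T hT hTu
      have := hns (T.map (Function.Embedding.subtype _)) (by
        intro x hx
        simp only [Finset.mem_map, Function.Embedding.subtype_apply] at hx
        obtain ⟨y, _, rfl⟩ := hx
        exact y.2) (by simpa using hT) (by
        intro h
        apply hTu
        apply Finset.eq_univ_of_card
        rw [← Finset.card_map (Function.Embedding.subtype _), h]; simp)
      simpa using this)
    (fun p hp => hgcd S ⟨i0, hi0⟩ hS0 p fun i hi => hp ⟨i, hi⟩)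
    D ⟨m, hmS⟩ (fun i => hm i i.2) _ rfl rfl
  set dS := Module.finrank ℂ (Submodule.span ℂ (Set.range fun i : S => f i)) with hdS
  have hdle : dS ≤ d := by
    rw [hd, hdS]
    have : Module.Finite ℂ (Submodule.span ℂ (Set.range f)) :=
      Module.Finite.span_of_finite ℂ (Set.finite_range f)
    refine Submodule.finrank_mono (Submodule.span_mono ?_)
    rintro _ ⟨i, rfl⟩
    exact ⟨i, rfl⟩
  have hdS2 : 2 ≤ dS := by
    by_contra h
    have : dS - 1 = 0 := by omega
    rw [this] at hcore
    omega
  rw [Finset.sum_coe_sort S (fun i => (g i).natDegree)] at hcore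
  have h1 : D < (dS - 1) * ∑ i ∈ S, (g i).natDegree := by omega
  have h2 : (D : ℚ) < ((dS : ℚ) - 1) * ∑ i ∈ S, ((g i).natDegree : ℚ) := by
    have : (D : ℚ) < (((dS - 1) * ∑ i ∈ S, (g i).natDegree : ℕ) : ℚ) := by exact_mod_cast h1
    rw [Nat.cast_mul, Nat.cast_sub (by omega), Nat.cast_sum] at this
    simpa using this
  have h3 : ∑ i ∈ S, ((g i).natDegree : ℚ) ≤ D * ∑ i, (1 : ℚ) / (e i : ℚ) := by
    calc ∑ i ∈ S, ((g i).natDegree : ℚ) ≤ ∑ i ∈ S, (D : ℚ) * ((1 : ℚ) / (e i : ℚ)) := by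
          refine Finset.sum_le_sum fun i hi => ?_
          have hei : (0 : ℚ) < e i := by exact_mod_cast he i
          rw [mul_one_div, le_div_iff₀ hei]
          have h4 := hm i hi
          rw [hf i, natDegree_pow] at h4
          rw [mul_comm]
          exact_mod_cast h4
      _ = D * ∑ i ∈ S, (1 : ℚ) / (e i : ℚ) := by rw [Finset.mul_sum]
      _ ≤ D * ∑ i, (1 : ℚ) / (e i : ℚ) := by
          refine mul_le_mul_of_nonneg_left ?_ (by positivity)
          exact Finset.sum_le_sum_of_subset_of_nonneg (Finset.subset_univ _)
            fun i _ _ => by positivity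
  have hDq : (0 : ℚ) < D := by exact_mod_cast hDpos
  have hdSq : (1 : ℚ) ≤ (dS : ℚ) - 1 := by
    have : (2 : ℚ) ≤ dS := by exact_mod_cast hdS2
    linarith
  have hdq : (dS : ℚ) - 1 ≤ (d : ℚ) - 1 := by
    have : (dS : ℚ) ≤ d := by exact_mod_cast hdle
    linarith
  have hE : (0 : ℚ) ≤ ∑ i, (1 : ℚ) / (e i : ℚ) := Finset.sum_nonneg fun i _ => by positivity
  rw [div_lt_iff₀ (by linarith)]
  have h5 : (D : ℚ) * 1 < D * ((∑ i, (1 : ℚ) / (e i : ℚ)) * ((d : ℚ) - 1)) := by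
    calc (D : ℚ) * 1 < ((dS : ℚ) - 1) * ∑ i ∈ S, ((g i).natDegree : ℚ) := by linarith
      _ ≤ ((dS : ℚ) - 1) * (D * ∑ i, (1 : ℚ) / (e i : ℚ)) :=
          mul_le_mul_of_nonneg_left h3 (by linarith)
      _ ≤ ((d : ℚ) - 1) * (D * ∑ i, (1 : ℚ) / (e i : ℚ)) :=
          mul_le_mul_of_nonneg_right hdq (by positivity)
      _ = _ := by ring
  exact lt_of_mul_lt_mul_left h5 hDq.le
end

section
/- Let n ≥ 2 and g₁, …, gₙ be univariate polynomials over ℂ, not all zero, satisfying g₁^d + g₂^d + ⋯ + gₙ^d = 0 for some integer d ≥ n(n−2). Then the vanishing sum g₁^d + ⋯ + gₙ^d decomposes into vanishing subsums g_{i₁}^d + ⋯ + g_{i_s}^d = 0 such that within each subsum all g_{i_j} are pairwise similar (i.e., scalar multiples of each other by nonzero constants). -/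
open Polynomial

namespace Stmt11Aux

/-- Wronskian matrix. -/
noncomputable def wr {m : ℕ} (f : Fin m → ℂ[X]) : Matrix (Fin m) (Fin m) ℂ[X] :=
  Matrix.of fun i j => derivative^[(i : ℕ)] (f j)

lemma natDegree_eq_of_wr {a b : ℂ[X]} (ha : a ≠ 0) (hb : b ≠ 0)
    (h : b * derivative a = derivative b * a) : a.natDegree = b.natDegree := by
  have key : ∀ p q : ℂ[X], (q * derivative p).coeff (q.natDegree + p.natDegree - 1) =
      q.leadingCoeff * (p.leadingCoeff * p.natDegree) := by
    intro p q
    rcases Nat.eq_zero_or_pos p.natDegree with h0 | h0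
    · rw [Polynomial.derivative_of_natDegree_zero h0]; simp [h0]
    · have : q.natDegree + p.natDegree - 1 = q.natDegree + (p.natDegree - 1) := by omega
      rw [this, Polynomial.coeff_mul_add_eq_of_natDegree_le le_rfl
        (Polynomial.natDegree_derivative_le p), coeff_derivative]
      have h2 : p.natDegree - 1 + 1 = p.natDegree := by omega
      rw [h2]
      have h3 : ((p.natDegree - 1 : ℕ) : ℂ) + 1 = p.natDegree := by exact_mod_cast h2
      rw [h3]; rfl
  have h1 := key a b
  have h2 := key b a
  rw [h, mul_comm (derivative b) a, add_comm, h2] at h1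
  have hla : a.leadingCoeff ≠ 0 := by simpa using ha
  have hlb : b.leadingCoeff ≠ 0 := by simpa using hb
  have h3 : a.leadingCoeff * b.leadingCoeff * ((b.natDegree : ℂ) - a.natDegree) = 0 := by
    linear_combination h1
  have h4 : ((b.natDegree : ℂ) - a.natDegree) = 0 := by
    simpa [hla, hlb] using h3
  have h5 : (b.natDegree : ℂ) = a.natDegree := by linear_combination h4
  exact_mod_cast h5.symm

lemma const_mul_of_wr {a b : ℂ[X]} (hb : b ≠ 0)
    (h : b * derivative a = derivative b * a) : ∃ c : ℂ, a = C c * b := by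
  by_cases ha : a = 0
  · exact ⟨0, by simp [ha]⟩
  have hlb : b.leadingCoeff ≠ 0 := by simpa using hb
  have hdeg := natDegree_eq_of_wr ha hb h
  refine ⟨a.leadingCoeff / b.leadingCoeff, ?_⟩
  set c := a.leadingCoeff / b.leadingCoeff with hc
  have hc0 : c ≠ 0 := div_ne_zero (by simpa using ha) hlb
  by_contra hne
  have hr : a - C c * b ≠ 0 := sub_ne_zero.mpr hne
  have h' : b * derivative (a - C c * b) = derivative b * (a - C c * b) := by
    simp only [derivative_sub, derivative_C_mul]
    linear_combination h
  have hd := natDegree_eq_of_wr hr hb h'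
  have hz : (a - C c * b).coeff b.natDegree = 0 := by
    rw [coeff_sub, coeff_C_mul]
    have e1 : a.coeff b.natDegree = a.leadingCoeff := by rw [← hdeg]; rfl
    have e2 : b.coeff b.natDegree = b.leadingCoeff := rfl
    rw [e1, e2, hc]; field_simp; ring
  rw [← hd] at hz
  exact hr (leadingCoeff_eq_zero.mp hz)

lemma wr_det_ne_zero : ∀ (m : ℕ) (f : Fin m → ℂ[X]), LinearIndependent ℂ f → (wr f).det ≠ 0 := by
  intro m
  induction m with
  | zero => intro f _; simp
  | succ m ih =>
    intro f hf hdet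
    obtain ⟨v, hv, hMv⟩ := Matrix.exists_mulVec_eq_zero_iff.mpr hdet
    have hW := ih (fun j => f j.castSucc) (hf.comp _ (Fin.castSucc_injective m))
    have hrel : ∀ i : Fin (m+1), ∑ j, derivative^[(i:ℕ)] (f j) * v j = 0 := by
      intro i
      have := congrFun hMv i
      simpa [Matrix.mulVec, dotProduct, wr] using this
    have hnon : ∀ u : Fin m → ℂ[X],
        (∀ i : Fin m, ∑ j : Fin m, derivative^[(i:ℕ)] (f j.castSucc) * u j = 0) → u = 0 := by
      intro u hu
      apply Matrix.eq_zero_of_mulVec_eq_zero hW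
      funext i
      simpa [Matrix.mulVec, dotProduct, wr] using hu i
    have hrel' : ∀ i : Fin m, ∑ j, derivative^[(i:ℕ)] (f j) * derivative (v j) = 0 := by
      intro i
      have h1 := hrel i.castSucc
      have h2 := hrel i.succ
      have h3 := congrArg derivative h1
      simp only [Fin.val_castSucc, derivative_sum, derivative_mul, derivative_zero,
        Finset.sum_add_distrib] at h3
      simp only [Fin.val_succ, Function.iterate_succ_apply'] at h2
      rw [h2, zero_add] at h3
      exact h3
    have hlast : v (Fin.last m) ≠ 0 := by
      intro h0
      apply hv
      have := hnon (fun j => v j.castSucc) (by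
        intro i
        have h1 := hrel i.castSucc
        rw [Fin.sum_univ_castSucc] at h1
        simpa [h0] using h1)
      funext j
      refine Fin.lastCases h0 (fun j => congrFun this j) j
    have hu := hnon (fun j => v (Fin.last m) * derivative (v j.castSucc)
        - derivative (v (Fin.last m)) * v j.castSucc) (by
      intro i
      have h1 := hrel i.castSucc
      have h2 := hrel' i
      rw [Fin.sum_univ_castSucc] at h1 h2
      simp only [Fin.val_castSucc] at h1
      have e : ∑ j : Fin m, derivative^[(i:ℕ)] (f j.castSucc) *
          (v (Fin.last m) * derivative (v j.castSucc)
            - derivative (v (Fin.last m)) * v j.castSucc) =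
          v (Fin.last m) * ∑ j : Fin m, derivative^[(i:ℕ)] (f j.castSucc) *
            derivative (v j.castSucc) - derivative (v (Fin.last m)) *
            ∑ j : Fin m, derivative^[(i:ℕ)] (f j.castSucc) * v j.castSucc := by
        rw [Finset.mul_sum, Finset.mul_sum, ← Finset.sum_sub_distrib]
        refine Finset.sum_congr rfl fun j _ => by ring
      rw [e]
      linear_combination v (Fin.last m) * h2 - derivative (v (Fin.last m)) * h1)
    have hc : ∀ j : Fin (m+1), ∃ c : ℂ, v j = C c * v (Fin.last m) := by
      intro j
      apply const_mul_of_wr hlast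
      refine Fin.lastCases (by ring) (fun j => ?_) j
      have := congrFun hu j
      simp only [Pi.zero_apply] at this
      exact sub_eq_zero.mp this
    choose c hc using hc
    have hz : v (Fin.last m) * ∑ j, c j • f j = 0 := by
      have h0 := hrel 0
      rw [Finset.mul_sum, ← h0]
      refine Finset.sum_congr rfl fun j _ => ?_
      rw [hc j, smul_eq_C_mul]
      simp only [Fin.val_zero, Function.iterate_zero, id]
      ring
    have hz' := (mul_eq_zero.mp hz).resolve_left hlast
    have hc0 := Fintype.linearIndependent_iff.mp hf c hz' (Fin.last m)
    apply hlast
    rw [hc (Fin.last m), hc0]; simp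

lemma pow_dvd_iterate (h : ℂ[X]) (d N : ℕ) : ∀ i, i ≤ N → h ^ (d - N) ∣ derivative^[i] (h ^ d) := by
  intro i hi
  exact (pow_dvd_pow h (by omega)).trans (Polynomial.pow_sub_dvd_iterate_derivative_pow h d i)

lemma prod_dvd_wr {m d : ℕ} (h : Fin (m+1) → ℂ[X]) :
    ∏ j, h j ^ (d - m) ∣ (wr fun j => h j ^ d).det := by
  have : ∀ i j : Fin (m+1), ∃ q, derivative^[(i:ℕ)] (h j ^ d) = h j ^ (d - m) * q := by
    intro i j
    exact pow_dvd_iterate (h j) d m i (by omega)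
  choose q hq using this
  refine ⟨(Matrix.of q).det, ?_⟩
  rw [← Matrix.det_mul_row]
  congr 1
  ext1 i j
  simp [wr, hq]

lemma wr_update {m : ℕ} (f : Fin m → ℂ[X]) (f0 : ℂ[X]) (hs : ∑ j, f j + f0 = 0) (i : Fin m) :
    (wr (Function.update f i (-f0))).det = (wr f).det := by
  have h := Matrix.det_updateCol_sum (wr f) i (fun _ => 1)
  rw [one_smul] at h
  rw [← h]
  congr 1
  ext1 a b
  by_cases hb : b = i
  · subst hb
    have : -f0 = ∑ j, f j := by linear_combination -hs
    simp [wr, this, Polynomial.iterate_derivative_sum]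
  · simp [wr, Matrix.updateCol_ne, hb]

lemma wr_natDegree {m : ℕ} (f : Fin (m+2) → ℂ[X]) (hne : (wr f).det ≠ 0) :
    (wr f).det.natDegree + 1 ≤ ∑ j, (f j).natDegree := by
  have hd : (wr f).det.degree < ((∑ j, (f j).natDegree : ℕ) : WithBot ℕ) := by
    rw [Matrix.det_apply]
    refine (Polynomial.degree_sum_le _ _).trans_lt ?_
    rw [Finset.sup_lt_iff (WithBot.bot_lt_coe _)]
    intro σ _
    have hle : (Equiv.Perm.sign σ • ∏ i, wr f (σ i) i).degree ≤ (∏ i, wr f (σ i) i).degree := by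
      rcases Int.units_eq_one_or (Equiv.Perm.sign σ) with h | h <;> simp [h]
    refine hle.trans_lt ?_
    by_cases h0 : ∏ i, wr f (σ i) i = 0
    · rw [h0, degree_zero]; exact WithBot.bot_lt_coe _
    rw [degree_eq_natDegree h0]
    rw [Polynomial.natDegree_prod _ _ (fun i hi => (Finset.prod_ne_zero_iff.mp h0 i hi))]
    have : ∑ i, (wr f (σ i) i).natDegree < ∑ j, (f j).natDegree := by
      apply Finset.sum_lt_sum
      · intro i _
        exact (Polynomial.natDegree_iterate_derivative _ _).trans (Nat.sub_le _ _)
      · refine ⟨σ.symm 1, Finset.mem_univ _, ?_⟩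
        have hnz := Finset.prod_ne_zero_iff.mp h0 (σ.symm 1) (Finset.mem_univ _)
        simp only [wr, Matrix.of_apply, Equiv.apply_symm_apply, Fin.val_one,
          Function.iterate_one] at hnz ⊢
        apply Polynomial.natDegree_derivative_lt
        intro hz
        exact hnz (Polynomial.derivative_of_natDegree_zero hz)
    exact_mod_cast this
  rw [degree_eq_natDegree hne] at hd
  have : (wr f).det.natDegree < ∑ j, (f j).natDegree := by exact_mod_cast hd
  omega

lemma core' {m d : ℕ} (h : Fin (m+2) → ℂ[X]) (h0 : ℂ[X]) (hd : (m+3)*(m+1) ≤ d)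
    (hs : ∑ j, h j ^ d + h0 ^ d = 0) (hli : LinearIndependent ℂ fun j => h j ^ d)
    (hh0 : h0 ≠ 0)
    (hdeg : ∀ j, (h j).natDegree ≤ h0.natDegree)
    (hspan : Ideal.span (insert h0 (Set.range h)) = ⊤) : False := by
  have hW := wr_det_ne_zero _ _ hli
  set W := (wr fun j => h j ^ d).det with hWdef
  set e := d - (m+1) with he
  set P := h0 ^ e * ∏ j, h j ^ e with hP
  have hd0 : d ≠ 0 := by rintro rfl; simp at hd
  have hhne : ∀ j, h j ≠ 0 := by
    intro j hj
    apply hli.ne_zero j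
    simp [hj, hd0]
  have hdvd0 : ∏ j, h j ^ e ∣ W := prod_dvd_wr h
  have hdvd : ∀ i, h0 ^ e * ∏ j ∈ Finset.univ.erase i, h j ^ e ∣ W := by
    intro i
    obtain ⟨z, hz⟩ := IsAlgClosed.exists_pow_nat_eq (-1 : ℂ) (Nat.pos_of_ne_zero hd0)
    have h1 := prod_dvd_wr (d := d) (Function.update h i (C z * h0))
    have h2 : (fun j => (Function.update h i (C z * h0)) j ^ d) =
        Function.update (fun j => h j ^ d) i (-(h0 ^ d)) := by
      funext j
      by_cases hj : j = i
      · subst hj; simp [mul_pow, ← C_pow, hz]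
      · simp [hj]
    rw [h2, wr_update _ _ hs] at h1
    refine dvd_trans ?_ h1
    rw [← Finset.mul_prod_erase _ _ (Finset.mem_univ i)]
    apply mul_dvd_mul
    · simp only [Function.update_self]
      exact pow_dvd_pow_of_dvd (Dvd.intro_left _ rfl) _
    · apply dvd_of_eq
      refine Finset.prod_congr rfl fun j hj => ?_
      rw [Function.update_of_ne (Finset.ne_of_mem_erase hj)]
  have hPW : P ∣ W := by
    have h1 := Ideal.span_pow_eq_top _ hspan e
    have h2 : (1 : ℂ[X]) ∈ Ideal.span ((fun x => x ^ e) '' insert h0 (Set.range h)) := by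
      rw [h1]; trivial
    have h3 : ∀ x ∈ Ideal.span ((fun x => x ^ e) '' insert h0 (Set.range h)), P ∣ W * x := by
      intro x hx
      refine Submodule.span_induction ?_ ?_ ?_ ?_ hx
      · rintro _ ⟨y, hy, rfl⟩
        rcases hy with rfl | ⟨i, rfl⟩
        · rw [hP, mul_comm]; exact mul_dvd_mul hdvd0 dvd_rfl
        · rw [hP, ← Finset.prod_erase_mul _ _ (Finset.mem_univ i), ← mul_assoc]
          exact mul_dvd_mul (hdvd i) dvd_rfl
      · simp
      · intro x y _ _ hx hy
        rw [mul_add]; exact dvd_add hx hy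
      · intro a x _ hx
        rw [smul_eq_mul, mul_left_comm]; exact hx.mul_left a
    simpa using h3 1 h2
  have hdegP := Polynomial.natDegree_le_of_dvd hPW hW
  have hdW := wr_natDegree _ hW
  have hPdeg : P.natDegree = e * h0.natDegree + e * ∑ j, (h j).natDegree := by
    rw [hP, natDegree_mul (pow_ne_zero _ hh0)
      (Finset.prod_ne_zero_iff.mpr fun j _ => pow_ne_zero _ (hhne j)), natDegree_pow,
      natDegree_prod _ _ (fun j _ => pow_ne_zero _ (hhne j)), Finset.mul_sum]
    simp
  simp only [natDegree_pow, ← Finset.mul_sum] at hdW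
  have hS : ∑ j, (h j).natDegree ≤ (m+2) * h0.natDegree := by
    refine (Finset.sum_le_sum fun j _ => hdeg j).trans ?_
    simp
  have hde : d = e + (m+1) := by
    have : m + 1 ≤ (m+3)*(m+1) := by nlinarith
    omega
  have hee : (m+2)*(m+1) ≤ e := by nlinarith
  rw [hPdeg] at hdegP
  generalize (∑ j, (h j).natDegree) = S at *
  generalize h0.natDegree = D at *
  have hdW' : W.natDegree + 1 ≤ d * S := hdW
  rw [hde] at hdW'
  have a1 : e * D + 1 ≤ (m+1) * S := by nlinarith
  have a2 : (m+1) * S ≤ (m+1) * ((m+2) * D) := Nat.mul_le_mul_left _ hS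
  have a3 := Nat.mul_le_mul_right D hee
  nlinarith

lemma core {m d : ℕ} (h : Fin (m+2) → ℂ[X]) (h0 : ℂ[X]) (hd : (m+3)*(m+1) ≤ d)
    (hs : ∑ j, h j ^ d + h0 ^ d = 0) (hli : LinearIndependent ℂ fun j => h j ^ d)
    (hh0 : h0 ≠ 0)
    (hdeg : ∀ j, (h j).natDegree ≤ h0.natDegree) : False := by
  obtain ⟨G, hG⟩ := (IsPrincipalIdealRing.principal
    (Ideal.span (insert h0 (Set.range h)))).principal
  have hG' : Ideal.span (insert h0 (Set.range h)) = Ideal.span {G} := hG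
  have hd0 : d ≠ 0 := by rintro rfl; simp at hd
  have m0 : G ∣ h0 := by
    rw [← Ideal.mem_span_singleton, ← hG']
    exact Ideal.subset_span (by simp)
  have mj : ∀ j, G ∣ h j := by
    intro j
    rw [← Ideal.mem_span_singleton, ← hG']
    exact Ideal.subset_span (by simp)
  obtain ⟨k0, hk0⟩ := m0
  choose k hk using mj
  have hGne : G ≠ 0 := by rintro rfl; simp at hk0; exact hh0 hk0
  have hk0ne : k0 ≠ 0 := by rintro rfl; simp at hk0; exact hh0 hk0
  have hhne : ∀ j, h j ≠ 0 := by
    intro j hj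
    apply hli.ne_zero j
    simp [hj, hd0]
  have hkne : ∀ j, k j ≠ 0 := by
    intro j hj
    apply hhne j
    rw [hk j, hj, mul_zero]
  apply core' k k0 hd ?_ ?_ hk0ne
  · intro j
    have := hdeg j
    rw [hk j, hk0, natDegree_mul hGne (hkne j), natDegree_mul hGne hk0ne] at this
    omega
  · have h1 : Ideal.span (insert h0 (Set.range h)) =
        Ideal.span {G} * Ideal.span (insert k0 (Set.range k)) := by
      rw [Ideal.span_mul_span']
      congr 1
      ext x
      simp [Set.mem_mul, hk, hk0, eq_comm]
    have h2 : Ideal.span {G} * Ideal.span (insert k0 (Set.range k)) = Ideal.span {G} * ⊤ := by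
      rw [← h1, hG', Ideal.mul_top]
    have h3 : G ∈ Ideal.span {G} * Ideal.span (insert k0 (Set.range k)) := by
      rw [h2, Ideal.mul_top]; exact Ideal.mem_span_singleton_self G
    rw [Ideal.mem_span_singleton_mul] at h3
    obtain ⟨z, hz, hz'⟩ := h3
    have : z = 1 := mul_left_cancel₀ hGne (by rw [hz', mul_one])
    rw [Ideal.eq_top_iff_one, ← this]; exact hz
  · apply mul_left_cancel₀ (pow_ne_zero d hGne)
    rw [mul_zero, mul_add, Finset.mul_sum, ← hs, hk0, mul_pow]
    congr 1
    exact Finset.sum_congr rfl fun j _ => by rw [hk j, mul_pow]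
  · apply LinearIndependent.of_comp (LinearMap.mulLeft ℂ (G ^ d))
    have hfe : (fun j => h j ^ d) = (LinearMap.mulLeft ℂ (G ^ d)) ∘ fun j => k j ^ d := by
      funext j
      simp [hk j, mul_pow]
    rw [hfe] at hli
    exact hli

lemma main_indep (d : ℕ) (hd1 : d ≠ 0) : ∀ (k : ℕ) (h : Fin k → ℂ[X]), (∀ i, h i ≠ 0) →
    (∀ i j, i ≠ j → ¬ ∃ c : ℂ, c ≠ 0 ∧ h j = C c * h i) → k * (k - 2) ≤ d →
    LinearIndependent ℂ fun j => h j ^ d := by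
  intro k
  induction k with
  | zero => intro h _ _ _; exact linearIndependent_empty_type
  | succ k ih =>
    intro h hne hsim hd
    have hsub : ∀ p : Fin (k+1), LinearIndependent ℂ fun j => h (p.succAbove j) ^ d := by
      intro p
      refine ih (fun j => h (p.succAbove j)) (fun j => hne _) (fun i j hij =>
        hsim _ _ (fun hc => hij (Fin.succAbove_right_injective hc))) (le_trans ?_ hd)
      exact Nat.mul_le_mul (by omega) (by omega)
    rw [Fintype.linearIndependent_iff]
    intro c hc
    by_contra hcon
    push Not at hcon
    obtain ⟨i0, hi0⟩ := hcon
    have hcne : ∀ p, c p ≠ 0 := by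
      intro p hp
      rw [Fin.sum_univ_succAbove _ p, hp, zero_smul, zero_add] at hc
      have := Fintype.linearIndependent_iff.mp (hsub p) (fun j => c (p.succAbove j)) hc
      apply hi0
      by_cases h1 : i0 = p
      · rw [h1, hp]
      · obtain ⟨j, rfl⟩ := Fin.exists_succAbove_eq h1
        exact this j
    have hμ : ∀ p, ∃ μ : ℂ, μ ^ d = c p := fun p =>
      IsAlgClosed.exists_pow_nat_eq (c p) (Nat.pos_of_ne_zero hd1)
    choose μ hμ using hμ
    have hμne : ∀ p, μ p ≠ 0 := by
      intro p hp
      apply hcne p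
      rw [← hμ p, hp, zero_pow hd1]
    have hterm : ∀ p, c p • h p ^ d = (C (μ p) * h p) ^ d := by
      intro p
      rw [mul_pow, ← C_pow, hμ, smul_eq_C_mul]
    have hHne : ∀ p, C (μ p) * h p ≠ 0 := fun p =>
      mul_ne_zero (by simpa using hμne p) (hne p)
    simp only [hterm] at hc
    rcases k with _ | _ | m
    · rw [Fin.sum_univ_one] at hc
      exact pow_ne_zero d (hHne 0) hc
    · rw [Fin.sum_univ_two] at hc
      have e1 : (C (μ 0) * h 0) ^ d = -(C (μ 1) * h 1) ^ d := by linear_combination hc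
      have d1 : C (μ 0) * h 0 ∣ C (μ 1) * h 1 := by
        rw [← IsIntegrallyClosed.pow_dvd_pow_iff hd1, e1]; simp
      have d2 : C (μ 1) * h 1 ∣ C (μ 0) * h 0 := by
        rw [← IsIntegrallyClosed.pow_dvd_pow_iff hd1, e1]; simp
      obtain ⟨u, hu⟩ := associated_of_dvd_dvd d1 d2
      obtain ⟨r, hr, hru⟩ := Polynomial.isUnit_iff.mp u.isUnit
      apply hsim 0 1 (by simp)
      refine ⟨(μ 1)⁻¹ * (μ 0 * r), by
        have := hr.ne_zero
        have h0 := hμne 0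
        have h1 := hμne 1
        simp [this, h0, h1], ?_⟩
      rw [← hru] at hu
      have hinv : C (μ 1)⁻¹ * C (μ 1) = (1 : ℂ[X]) := by
        rw [← C_mul, inv_mul_cancel₀ (hμne 1), C_1]
      rw [C_mul, C_mul]
      linear_combination (-h 1) * hinv - C (μ 1)⁻¹ * hu
    · obtain ⟨p, hp⟩ := Finite.exists_max (fun i => (h i).natDegree)
      rw [Fin.sum_univ_succAbove _ p, add_comm] at hc
      refine core _ _ hd hc ?_ (hHne p) ?_
      · have hu := (hsub p).units_smul (fun j => Units.mk0 (c (p.succAbove j)) (hcne _))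
        convert hu using 1
        funext j
        exact (hterm _).symm
      · intro j
        rw [natDegree_C_mul (hμne _), natDegree_C_mul (hμne _)]
        exact hp _

end Stmt11Aux

theorem stmt11 (n : ℕ) (hn : 2 ≤ n) (g : Fin n → ℂ[X]) (hne : ∃ i, g i ≠ 0)
    (d : ℕ) (hd : n * (n - 2) ≤ d)
    (hsum : ∑ i, g i ^ d = 0) :
    ∃ P : Finset (Finset (Fin n)),
      (∀ B ∈ P, ∀ B' ∈ P, B ≠ B' → Disjoint B B') ∧
      (∀ B ∈ P, ∀ i ∈ B, g i ≠ 0) ∧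
      (∀ i : Fin n, g i ≠ 0 → ∃ B ∈ P, i ∈ B) ∧
      (∀ B ∈ P, (∑ i ∈ B, g i ^ d = 0) ∧
        ∀ i ∈ B, ∀ j ∈ B, ∃ lam : ℂ, lam ≠ 0 ∧ g j = C lam * g i) := by
  classical
  have hd1 : d ≠ 0 := by
    rintro rfl
    simp at hsum
    omega
  let S : Setoid (Fin n) :=
    { r := fun i j => ∃ lam : ℂ, lam ≠ 0 ∧ g j = C lam * g i
      iseqv :=
        { refl := fun i => ⟨1, one_ne_zero, by simp⟩
          symm := by
            rintro i j ⟨a, ha, h⟩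
            refine ⟨a⁻¹, inv_ne_zero ha, ?_⟩
            rw [h, ← mul_assoc, ← C_mul, inv_mul_cancel₀ ha, C_1, one_mul]
          trans := by
            rintro i j k ⟨a, ha, h⟩ ⟨b, hb, h'⟩
            refine ⟨b * a, mul_ne_zero hb ha, ?_⟩
            rw [h', h, C_mul, mul_assoc] } }
  let T := {q : Quotient S // g q.out ≠ 0}
  have hout : ∀ i : Fin n, ∃ lam : ℂ, lam ≠ 0 ∧ g i = C lam * g (Quotient.mk S i).out :=
    fun i => Quotient.mk_out (s := S) i
  choose l hl hgl using hout
  have hnz : ∀ i, g i ≠ 0 ↔ g (Quotient.mk S i).out ≠ 0 := by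
    intro i
    constructor
    · intro h h0
      apply h; rw [hgl i, h0, mul_zero]
    · intro h
      rw [hgl i]
      exact mul_ne_zero (by simpa using hl i) h
  have hcard : Fintype.card T ≤ n := by
    refine (Fintype.card_subtype_le _).trans ?_
    refine (Fintype.card_quotient_le S).trans ?_
    simp
  let e := (Fintype.equivFin T).symm
  have hind : LinearIndependent ℂ fun j => g (e j).1.out ^ d := by
    refine Stmt11Aux.main_indep d hd1 _ (fun j => g (e j).1.out) (fun j => (e j).2) ?_ ?_
    · intro i j hij hs
      apply hij
      apply e.injective
      apply Subtype.ext
      have : Quotient.mk S (e i).1.out = Quotient.mk S (e j).1.out := Quotient.sound hs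
      simpa using this
    · exact le_trans (Nat.mul_le_mul hcard (by omega)) hd
  have hclass : ∀ q : Quotient S, ∑ i with Quotient.mk S i = q, g i ^ d =
      (∑ i with Quotient.mk S i = q, l i ^ d) • g q.out ^ d := by
    intro q
    rw [Finset.sum_smul]
    refine Finset.sum_congr rfl fun i hi => ?_
    have hq := (Finset.mem_filter.mp hi).2
    conv_lhs => rw [hgl i]
    rw [hq, mul_pow, ← C_pow, smul_eq_C_mul]
  have hzero : ∀ q : Quotient S, g q.out ≠ 0 → ∑ i with Quotient.mk S i = q, g i ^ d = 0 := by
    intro q hq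
    have htot : ∑ q : Quotient S, (∑ i with Quotient.mk S i = q, l i ^ d) • g q.out ^ d = 0 := by
      rw [← hsum, ← Finset.sum_fiberwise Finset.univ (fun i => Quotient.mk S i) (fun i => g i ^ d)]
      exact Finset.sum_congr rfl fun q _ => (hclass q).symm
    have htot2 : ∑ j, (∑ i with Quotient.mk S i = (e j).1, l i ^ d) • g (e j).1.out ^ d = 0 := by
      rw [e.sum_comp (fun t : T => (∑ i with Quotient.mk S i = t.1, l i ^ d) • g t.1.out ^ d)]
      refine Eq.trans (Eq.symm ?_) htot
      rw [← Finset.sum_filter_of_ne (p := fun q => g q.out ≠ 0)]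
      · exact Finset.sum_subtype _ (by simp) _
      · intro q _ h h0
        apply h; simp [h0, hd1]
    have := Fintype.linearIndependent_iff.mp hind _ htot2 (e.symm ⟨q, hq⟩)
    rw [hclass]
    simp only [Equiv.apply_symm_apply] at this
    rw [this, zero_smul]
  refine ⟨(Finset.univ.filter fun q : Quotient S => g q.out ≠ 0).image
    (fun q => Finset.univ.filter fun i => Quotient.mk S i = q), ?_, ?_, ?_, ?_⟩
  · intro B hB B' hB' hne
    obtain ⟨q, hq, rfl⟩ := Finset.mem_image.mp hB
    obtain ⟨q', hq', rfl⟩ := Finset.mem_image.mp hB'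
    rw [Finset.disjoint_left]
    intro i hi hi'
    apply hne
    rw [← (Finset.mem_filter.mp hi).2, ← (Finset.mem_filter.mp hi').2]
  · intro B hB i hi
    obtain ⟨q, hq, rfl⟩ := Finset.mem_image.mp hB
    rw [hnz, (Finset.mem_filter.mp hi).2]
    exact (Finset.mem_filter.mp hq).2
  · intro i hi
    refine ⟨_, Finset.mem_image_of_mem _ (Finset.mem_filter.mpr ⟨Finset.mem_univ
      (Quotient.mk S i), (hnz i).mp hi⟩), ?_⟩
    simp
  · intro B hB
    obtain ⟨q, hq, rfl⟩ := Finset.mem_image.mp hB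
    refine ⟨hzero q (Finset.mem_filter.mp hq).2, ?_⟩
    intro i hi j hj
    have : Quotient.mk S i = Quotient.mk S j := by
      rw [(Finset.mem_filter.mp hi).2, (Finset.mem_filter.mp hj).2]
    exact Quotient.exact this
end
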